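/- arXiv:1301.5149 — 4 statements merged into one kernel-verified Lean document; each statement's English description precedes it below -/
import Mathlib

section
/- In a Berge graph G, if a hole C and an antihole D both have at least 8 vertices, then C and D share at most 3 vertices, i.e. |V(C) ∩ V(D)| ≤ 3. -/
open SimpleGraph

/-- `G` contains a hole (induced cycle) on `n` vertices. -/
def HasHoleOfLength {V : Type} (G : SimpleGraph V) (n : ℕ) : Prop :=
  Nonempty (cycleGraph n ↪g G)

/-- A graph is Berge if neither it nor its complement contains an induced odd cycle
on at least 5 vertices (no odd hole, no odd antihole). -/
def IsBerge {V : Type} (G : SimpleGraph V) : Prop :=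
  ∀ n : ℕ, 5 ≤ n → Odd n → ¬ HasHoleOfLength G n ∧ ¬ HasHoleOfLength Gᶜ n

theorem cycleGraph_adj_iff_val {N : ℕ} (hN : 3 ≤ N) (u v : Fin N) :
    (cycleGraph N).Adj u v ↔ u.val + 1 = v.val ∨ v.val + 1 = u.val ∨
      (u.val = 0 ∧ v.val + 1 = N) ∨ (v.val = 0 ∧ u.val + 1 = N) := by
  have hu := u.isLt
  have hv := v.isLt
  rw [cycleGraph_adj', Fin.val_sub, Fin.val_sub]
  rcases Nat.lt_trichotomy u.val v.val with h | h | h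
  · rw [Nat.mod_eq_of_lt (by omega : N - v.val + u.val < N),
      Nat.mod_eq_sub_mod (by omega : N ≤ N - u.val + v.val), Nat.mod_eq_of_lt (by omega)]
    omega
  · rw [h, Nat.sub_add_cancel hv.le, Nat.mod_self]
    omega
  · rw [Nat.mod_eq_of_lt (by omega : N - u.val + v.val < N),
      Nat.mod_eq_sub_mod (by omega : N ≤ N - v.val + u.val), Nat.mod_eq_of_lt (by omega)]
    omega

/-- `r` restricted to `[0, n]` lists the vertices of an induced path of `H` in order. -/
def IsInducedPath {V : Type} (H : SimpleGraph V) (r : ℕ → V) (n : ℕ) : Prop :=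
  ∀ u ≤ n, ∀ v ≤ n, (H.Adj (r u) (r v) ↔ u + 1 = v ∨ v + 1 = u) ∧ (r u = r v → u = v)

/-- `S` is the vertex set of an induced path of `H` with `n` edges and ends `a`, `b`. -/
def SpansPath {V : Type} (H : SimpleGraph V) (S : Set V) (a b : V) (n : ℕ) : Prop :=
  ∃ r : ℕ → V, r 0 = a ∧ r n = b ∧ (∀ w, w ∈ S ↔ ∃ u ≤ n, r u = w) ∧ IsInducedPath H r n

theorem IsInducedPath.spansPath {V : Type} {H : SimpleGraph V} {r : ℕ → V} {n s t : ℕ}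
    (h : IsInducedPath H r n) (hst : s ≤ t) (htn : t ≤ n) :
    SpansPath H (r '' Set.Icc s t) (r s) (r t) (t - s) := by
  refine ⟨fun u => r (s + u), rfl, by simp only; congr 1; omega, fun w => ?_, fun u hu v hv => ?_⟩
  · simp only [Set.mem_image, Set.mem_Icc]
    constructor
    · rintro ⟨x, hx, rfl⟩
      exact ⟨x - s, by omega, by congr 1; omega⟩
    · rintro ⟨u, hu, rfl⟩
      exact ⟨s + u, by omega, rfl⟩
  · have := h (s + u) (by omega) (s + v) (by omega)
    constructor
    · rw [this.1]; omega
    · intro e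
      have := this.2 e
      omega

theorem SpansPath.snoc {V : Type} {H : SimpleGraph V} {S : Set V} {a b z : V} {n : ℕ}
    (h : SpansPath H S a b n) (hz : z ∉ S) (hb : H.Adj b z)
    (hS : ∀ w ∈ S, w ≠ b → ¬ H.Adj w z) : SpansPath H (insert z S) a z (n + 1) := by
  obtain ⟨r, h0, hn, hr, hp⟩ := h
  have hlast : ∀ u ≤ n, (H.Adj (r u) z ↔ u = n) ∧ r u ≠ z := by
    intro u hu
    refine ⟨⟨fun hadj => ?_, fun e => by rw [e, hn]; exact hb⟩,
      fun e => hz ((hr z).2 ⟨u, hu, e⟩)⟩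
    by_contra hne
    exact hS (r u) ((hr _).2 ⟨u, hu, rfl⟩)
      (fun e => hne ((hp u hu n le_rfl).2 (e.trans hn.symm))) hadj
  refine ⟨fun u => if u ≤ n then r u else z, by simp [h0], by simp, fun w => ?_,
    fun u hu v hv => ?_⟩
  · rw [Set.mem_insert_iff, hr]
    constructor
    · rintro (rfl | ⟨u, hu, rfl⟩)
      · exact ⟨n + 1, le_rfl, by simp⟩
      · exact ⟨u, by omega, by simp [hu]⟩
    · rintro ⟨u, hu, rfl⟩
      by_cases hun : u ≤ n
      · exact Or.inr ⟨u, hun, by simp [hun]⟩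
      · exact Or.inl (by simp [hun])
  · by_cases hun : u ≤ n <;> by_cases hvn : v ≤ n
    · simpa [hun, hvn] using hp u hun v hvn
    · have := hlast u hun
      simp only [hun, hvn, if_true, if_false]
      exact ⟨by rw [this.1]; omega, fun e => (this.2 e).elim⟩
    · have := hlast v hvn
      simp only [hun, hvn, if_true, if_false]
      exact ⟨by rw [H.adj_comm, this.1]; omega, fun e => (this.2 e.symm).elim⟩
    · simp only [hun, hvn, if_false]
      exact ⟨by simp only [SimpleGraph.irrefl, false_iff]; omega, fun _ => by omega⟩

theorem SpansPath.hasHole {V : Type} {H : SimpleGraph V} {S : Set V} {a b z : V} {n : ℕ}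
    (h : SpansPath H S a b n) (hn1 : 1 ≤ n) (hz : z ∉ S) (ha : H.Adj a z) (hb : H.Adj b z)
    (hS : ∀ w ∈ S, w ≠ a → w ≠ b → ¬ H.Adj w z) : HasHoleOfLength H (n + 2) := by
  obtain ⟨r, h0, hn, hr, hp⟩ := h
  have hlast : ∀ u ≤ n, (H.Adj (r u) z ↔ u = 0 ∨ u = n) ∧ r u ≠ z := by
    intro u hu
    refine ⟨⟨fun hadj => ?_, ?_⟩, fun e => hz ((hr z).2 ⟨u, hu, e⟩)⟩
    · by_contra! hne
      exact hS (r u) ((hr _).2 ⟨u, hu, rfl⟩)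
        (fun e => hne.1 ((hp u hu 0 (Nat.zero_le _)).2 (e.trans h0.symm)))
        (fun e => hne.2 ((hp u hu n le_rfl).2 (e.trans hn.symm))) hadj
    · rintro (rfl | rfl)
      · rwa [h0]
      · rwa [hn]
  have key : ∀ u v : Fin (n + 2),
      (H.Adj (if u.val ≤ n then r u else z) (if v.val ≤ n then r v else z) ↔
        (cycleGraph (n + 2)).Adj u v) ∧
      ((if u.val ≤ n then r u else z) = (if v.val ≤ n then r v else z) → u.val = v.val) := by
    intro u v
    rw [cycleGraph_adj_iff_val (by omega)]
    have hu := u.isLt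
    have hv := v.isLt
    by_cases hun : u.val ≤ n <;> by_cases hvn : v.val ≤ n
    · simp only [hun, hvn, if_true]
      have := hp u hun v hvn
      exact ⟨by rw [this.1]; omega, this.2⟩
    · have := hlast u hun
      simp only [hun, hvn, if_true, if_false]
      exact ⟨by rw [this.1]; omega, fun e => (this.2 e).elim⟩
    · have := hlast v hvn
      simp only [hun, hvn, if_true, if_false]
      exact ⟨by rw [H.adj_comm, this.1]; omega, fun e => (this.2 e.symm).elim⟩
    · simp only [hun, hvn, if_false]
      exact ⟨by simp only [SimpleGraph.irrefl, false_iff]; omega, fun _ => by omega⟩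
  exact ⟨⟨⟨fun u => if u.val ≤ n then r u else z, fun u v e => Fin.ext ((key u v).2 e)⟩,
    fun {u v} => (key u v).1⟩⟩

/-- Any two consecutive elements of `S` in `[0, k]` are at distance one or at even distance. -/
def HasGoodGaps (k : ℕ) (S : ℕ → Prop) : Prop :=
  ∀ i i', i < i' → i' ≤ k → S i → S i' → (∀ u, i < u → u < i' → ¬ S u) →
    i' = i + 1 ∨ Even (i' - i)

theorem HasGoodGaps.exists_mem {k : ℕ} {S : ℕ → Prop} (h : HasGoodGaps k S) (hk : Odd k)
    (hk3 : 3 ≤ k) (h0 : S 0) (hlast : S k) : ∃ u, 0 < u ∧ u < k ∧ S u := by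
  by_contra! hno
  rcases h 0 k (by omega) le_rfl h0 hlast hno with h | h
  · omega
  · exact (Nat.not_even_iff_odd.2 hk) (by simpa using h)

theorem HasGoodGaps.and_of_even {k : ℕ} {S T : ℕ → Prop} (hS : HasGoodGaps k S)
    (hT : HasGoodGaps k T)
    (hE : ∀ i i', i < i' → i' ≤ k → (S i ∧ ¬ T i ∧ T i' ∧ ¬ S i' ∨ T i ∧ ¬ S i ∧ S i' ∧ ¬ T i') →
      (∀ u, i < u → u < i' → ¬ S u ∧ ¬ T u) → Even (i' - i)) :
    HasGoodGaps k (fun i => S i ∧ T i) := by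
  intro i i' hii hik hi hi' hno
  by_contra! hcon
  have hodd := hcon.2
  have inv : ∀ u, i ≤ u → u < i' → ∃ σ τ, i ≤ σ ∧ σ ≤ u ∧ i ≤ τ ∧ τ ≤ u ∧ S σ ∧ T τ ∧
      (∀ w, σ < w → w ≤ u → ¬ S w) ∧ (∀ w, τ < w → w ≤ u → ¬ T w) ∧
      (σ ≤ τ → Even (σ - i)) ∧ (τ ≤ σ → Even (τ - i)) := by
    intro u hu
    induction u, hu using Nat.le_induction with
    | base =>
      intro _
      exact ⟨i, i, le_rfl, le_rfl, le_rfl, le_rfl, hi.1, hi.2, fun w _ _ => by omega,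
        fun w _ _ => by omega, by simp, by simp⟩
    | succ u hu ih =>
      intro hui
      obtain ⟨σ, τ, hσ, hσu, hτ, hτu, hSσ, hTτ, hnS, hnT, h1, h2⟩ := ih (by omega)
      have hnb := hno (u + 1) (by omega) hui
      by_cases hSu : S (u + 1)
      · have hTu : ¬ T (u + 1) := fun h => hnb ⟨hSu, h⟩
        refine ⟨u + 1, τ, by omega, le_rfl, hτ, by omega, hSu, hTτ, fun w _ _ => by omega,
          fun w hw hw' => ?_, fun _ => by omega, fun _ => ?_⟩
        · rcases Nat.lt_or_ge u w with h | h
          · rwa [show w = u + 1 by omega]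
          · exact hnT w hw h
        · rcases Nat.lt_or_ge σ τ with h | h
          · have e1 := hE τ (u + 1) (by omega) (by omega)
              (Or.inr ⟨hTτ, hnS τ h hτu, hSu, hTu⟩)
              (fun w hw hw' => ⟨hnS w (by omega) (by omega), hnT w hw (by omega)⟩)
            have e2 := hS σ (u + 1) (by omega) (by omega) hSσ hSu
              (fun w hw hw' => hnS w hw (by omega))
            have e3 := h1 h.le
            grind
          · exact h2 h
      · by_cases hTu : T (u + 1)
        · refine ⟨σ, u + 1, hσ, by omega, by omega, le_rfl, hSσ, hTu,
            fun w hw hw' => ?_, fun w _ _ => by omega, fun _ => ?_, fun _ => by omega⟩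
          · rcases Nat.lt_or_ge u w with h | h
            · rwa [show w = u + 1 by omega]
            · exact hnS w hw h
          · rcases Nat.lt_or_ge τ σ with h | h
            · have e1 := hE σ (u + 1) (by omega) (by omega)
                (Or.inl ⟨hSσ, hnT σ h hσu, hTu, hSu⟩)
                (fun w hw hw' => ⟨hnS w hw (by omega), hnT w (by omega) (by omega)⟩)
              have e2 := hT τ (u + 1) (by omega) (by omega) hTτ hTu
                (fun w hw hw' => hnT w hw (by omega))
              have e3 := h2 h.le
              grind
            · exact h1 h
        · refine ⟨σ, τ, hσ, by omega, hτ, by omega, hSσ, hTτ, fun w hw hw' => ?_,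
            fun w hw hw' => ?_, h1, h2⟩
          · rcases Nat.lt_or_ge u w with h | h
            · rwa [show w = u + 1 by omega]
            · exact hnS w hw h
          · rcases Nat.lt_or_ge u w with h | h
            · rwa [show w = u + 1 by omega]
            · exact hnT w hw h
  obtain ⟨σ, τ, hσ, hσu, hτ, hτu, hSσ, hTτ, hnS, hnT, h1, h2⟩ :=
    inv (i' - 1) (by omega) (by omega)
  have e1 := hS σ i' (by omega) hik hSσ hi'.1 (fun w hw hw' => hnS w hw (by omega))
  have e2 := hT τ i' (by omega) hik hTτ hi'.2 (fun w hw hw' => hnT w hw (by omega))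
  have hne : ¬ (σ = τ ∧ i < σ) := fun h => hno σ h.2 (by omega) ⟨hSσ, h.1 ▸ hTτ⟩
  grind

theorem HasGoodGaps.extremes {k : ℕ} {S : ℕ → Prop} (h : HasGoodGaps k S) {i i' : ℕ}
    (hi : S i) (hi' : S i') (hii : i < i') (hik : i' ≤ k) (hgap : i' ≠ i + 1)
    (hodd : ¬ Even (i' - i)) :
    ∃ a c, i < a ∧ a ≤ c ∧ c < i' ∧ S a ∧ S c ∧ (a = i + 1 ∨ Even (a - i)) ∧
      (i' = c + 1 ∨ Even (i' - c)) := by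
  classical
  have hex : ∃ u, i < u ∧ u < i' ∧ S u := by
    by_contra! hno
    rcases h i i' hii hik hi hi' hno with h | h
    · exact hgap h
    · exact hodd h
  have hne : ((Finset.Ioo i i').filter S).Nonempty := by
    obtain ⟨u, h1, h2, h3⟩ := hex
    exact ⟨u, by simp [h1, h2, h3]⟩
  obtain ⟨a, ha, hamin⟩ := Finset.exists_min_image _ id hne
  obtain ⟨c, hc, hcmax⟩ := Finset.exists_max_image _ id hne
  simp only [Finset.mem_filter, Finset.mem_Ioo, id] at ha hc hamin hcmax
  refine ⟨a, c, ha.1.1, hamin c hc, hc.1.2, ha.2, hc.2, ?_, ?_⟩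
  · refine h i a ha.1.1 (by omega) hi ha.2 fun u h1 h2 h3 => ?_
    have := hamin u ⟨⟨h1, by omega⟩, h3⟩
    omega
  · refine h c i' hc.1.2 hik hc.2 hi' fun u h1 h2 h3 => ?_
    have := hcmax u ⟨⟨by omega, h2⟩, h3⟩
    omega

theorem HasGoodGaps.and_of_odd {k : ℕ} {S T : ℕ → Prop} (hS : HasGoodGaps k S)
    (hT : HasGoodGaps k T)
    (hO : ∀ i i', i ≤ k → i' ≤ k → S i → ¬ T i → T i' → ¬ S i' → i' = i + 1 ∨ i = i' + 1)
    (hO3 : ∀ i, i + 3 ≤ k → S i → T i → S (i + 3) → T (i + 3) →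
      ¬ (S (i + 1) ∧ ¬ T (i + 1) ∧ T (i + 2) ∧ ¬ S (i + 2)) ∧
      ¬ (T (i + 1) ∧ ¬ S (i + 1) ∧ S (i + 2) ∧ ¬ T (i + 2))) :
    HasGoodGaps k (fun i => S i ∧ T i) := by
  intro i i' hii hik hi hi' hno
  by_contra! hcon
  obtain ⟨a, c, h1, h2, h3, hSa, hSc, h4, h5⟩ := hS.extremes hi.1 hi'.1 hii hik hcon.1
    (by simpa using hcon.2)
  obtain ⟨b, d, g1, g2, g3, hTb, hTd, g4, g5⟩ := hT.extremes hi.2 hi'.2 hii hik hcon.1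
    (by simpa using hcon.2)
  have hab : ∀ x y, i < x → x < i' → i < y → y < i' → S x → T y → y = x + 1 ∨ x = y + 1 :=
    fun x y hx hx' hy hy' hSx hTy => hO x y (by omega) (by omega) hSx
      (fun h => hno x hx hx' ⟨hSx, h⟩) hTy (fun h => hno y hy hy' ⟨h, hTy⟩)
  have k1 := hab a b h1 (by omega) g1 (by omega) hSa hTb
  have k2 := hab a d h1 (by omega) (by omega) (by omega) hSa hTd
  have k3 := hab c b (by omega) (by omega) g1 (by omega) hSc hTb
  have k4 := hab c d (by omega) (by omega) (by omega) (by omega) hSc hTd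
  have hodd := hcon.2
  rw [Nat.not_even_iff] at hodd
  rw [Nat.even_iff] at h4 h5 g4 g5
  have hcase : (i' = i + 3 ∧ a = i + 1 ∧ b = i + 2) ∨ (i' = i + 3 ∧ b = i + 1 ∧ a = i + 2) := by
    omega
  have hnT : ¬ T a := fun h => hno a h1 (by omega) ⟨hSa, h⟩
  have hnS : ¬ S b := fun h => hno b g1 (by omega) ⟨h, hTb⟩
  rcases hcase with ⟨rfl, rfl, rfl⟩ | ⟨rfl, rfl, rfl⟩
  · exact (hO3 i hik hi.1 hi.2 hi'.1 hi'.2).1 ⟨hSa, hnT, hTb, hnS⟩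
  · exact (hO3 i hik hi.1 hi.2 hi'.1 hi'.2).2 ⟨hTb, hnS, hSa, hnT⟩

/-- An induced odd path `p` and an induced odd antipath `q` such that the ends of `p` are
complete to the interior of `q` and the ends of `q` are anticomplete to the interior of `p`. -/
structure PathAntipath {V : Type} (G : SimpleGraph V) (p q : ℕ → V) (k l : ℕ) : Prop where
  berge : IsBerge G
  odd_k : Odd k
  odd_l : Odd l
  five_le_k : 5 ≤ k
  five_le_l : 5 ≤ l
  path : IsInducedPath G p k
  antipath : IsInducedPath Gᶜ q l
  adj_interior : ∀ j, 1 ≤ j → j < l → G.Adj (p 0) (q j) ∧ G.Adj (p k) (q j)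
  compl_adj_ends : ∀ i, 1 ≤ i → i < k → Gᶜ.Adj (p i) (q 0) ∧ Gᶜ.Adj (p i) (q l)

/-- `p i` is adjacent to each of `q s, …, q t`. -/
def CompleteTo {V : Type} (G : SimpleGraph V) (p q : ℕ → V) (s t i : ℕ) : Prop :=
  ∀ j, s ≤ j → j ≤ t → G.Adj (p i) (q j)

namespace PathAntipath

variable {V : Type} {G : SimpleGraph V} {p q : ℕ → V} {k l : ℕ}

theorem ne (h : PathAntipath G p q k l) {i j : ℕ} (hi : i ≤ k) (hj : 1 ≤ j) (hjl : j < l) :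
    p i ≠ q j := by
  intro e
  have h1 := h.adj_interior j hj hjl
  have h5 := h.five_le_k
  rw [← e, (h.path 0 (by omega) i hi).1, (h.path k le_rfl i hi).1] at h1
  omega

theorem compl_adj_iff (h : PathAntipath G p q k l) {i j : ℕ} (hi : i ≤ k) (hj : 1 ≤ j)
    (hjl : j < l) : Gᶜ.Adj (q j) (p i) ↔ ¬ G.Adj (p i) (q j) := by
  rw [compl_adj, G.adj_comm]
  exact and_iff_right (h.ne hi hj hjl).symm

theorem compl_adj_path_iff (h : PathAntipath G p q k l) {i i' : ℕ} (hi : i ≤ k) (hi' : i' ≤ k) :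
    Gᶜ.Adj (p i) (p i') ↔ i + 1 < i' ∨ i' + 1 < i := by
  have := h.path i hi i' hi'
  rw [compl_adj, this.1]
  constructor
  · rintro ⟨hne, h2⟩
    have : i ≠ i' := fun e => hne (by rw [e])
    omega
  · intro h2
    exact ⟨fun e => by have := this.2 e; omega, by omega⟩

theorem notMem_image (h : PathAntipath G p q k l) {i s t : ℕ} (hi : i ≤ k) (hs : 1 ≤ s)
    (htl : t < l) : p i ∉ q '' Set.Icc s t := by
  rintro ⟨j, hj, e⟩
  exact h.ne hi (hs.trans hj.1) (hj.2.trans_lt htl) e.symm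

theorem spansPath_snoc (h : PathAntipath G p q k l) {s t α : ℕ} (hs : 1 ≤ s) (hst : s < t)
    (htl : t < l) (hα : α ≤ k) (hS : CompleteTo G p q s (t - 1) α) (hT : ¬ G.Adj (p α) (q t)) :
    SpansPath Gᶜ (insert (p α) (q '' Set.Icc s t)) (q s) (p α) (t - s + 1) := by
  refine (h.antipath.spansPath hst.le htl.le).snoc (h.notMem_image hα hs htl)
    ((h.compl_adj_iff hα (by omega) htl).2 hT) ?_
  rintro _ ⟨j, hj, rfl⟩ hne
  rw [Set.mem_Icc] at hj
  rw [h.compl_adj_iff hα (by omega) (by omega), not_not]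
  have : j ≠ t := fun e => hne (by rw [e])
  exact hS j hj.1 (by omega)

theorem spansPath_snoc_snoc (h : PathAntipath G p q k l) {s t α ζ : ℕ} (hs : 1 ≤ s)
    (hst : s < t) (htl : t < l) (hα : α ≤ k) (hS : CompleteTo G p q s (t - 1) α)
    (hT : ¬ G.Adj (p α) (q t)) (hζ : ζ ≤ k) (hζc : CompleteTo G p q s t ζ)
    (hαζ : α + 1 < ζ ∨ ζ + 1 < α) :
    SpansPath Gᶜ (insert (p ζ) (insert (p α) (q '' Set.Icc s t))) (q s) (p ζ)
      (t - s + 1 + 1) := by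
  have hadj := (h.compl_adj_path_iff hα hζ).2 hαζ
  refine (h.spansPath_snoc hs hst htl hα hS hT).snoc ?_ hadj ?_
  · rw [Set.mem_insert_iff, not_or]
    exact ⟨hadj.ne', h.notMem_image hζ hs htl⟩
  · rintro _ (rfl | ⟨j, hj, rfl⟩) hne
    · exact (hne rfl).elim
    · rw [Set.mem_Icc] at hj
      rw [h.compl_adj_iff hζ (by omega) (by omega), not_not]
      exact hζc j hj.1 hj.2

theorem not_hasHole_compl (h : PathAntipath G p q k l) {n : ℕ} (hn : 5 ≤ n) (hodd : n % 2 = 1) :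
    ¬ HasHoleOfLength Gᶜ n :=
  (h.berge n hn (Nat.odd_iff.2 hodd)).2

/-- A vertex complete to `q (s + 1), …, q (t - 1)` but not adjacent to `q s` and `q t`. -/
theorem length_even_of_misses_both (h : PathAntipath G p q k l) {s t i : ℕ} (hst : s + 3 ≤ t)
    (htl : t ≤ l) (hik : i < k) (hs : Gᶜ.Adj (q s) (p i)) (ht : Gᶜ.Adj (q t) (p i))
    (hY : CompleteTo G p q (s + 1) (t - 1) i) : (t - s) % 2 = 0 := by
  by_contra hcon
  refine h.not_hasHole_compl (n := t - s + 2) (by omega) (by omega)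
    ((h.antipath.spansPath (by omega) htl).hasHole (z := p i) (by omega) ?_ hs ht ?_)
  · rintro ⟨j, hj, e⟩
    rw [Set.mem_Icc] at hj
    rcases Nat.eq_or_lt_of_le hj.1 with rfl | h1
    · exact hs.ne e
    rcases Nat.eq_or_lt_of_le hj.2 with rfl | h2
    · exact ht.ne e
    exact h.ne hik.le (by omega) (by omega) e.symm
  · rintro _ ⟨j, hj, rfl⟩ hne hne'
    rw [Set.mem_Icc] at hj
    have h1 : j ≠ s := fun e => hne (by rw [e])
    have h2 : j ≠ t := fun e => hne' (by rw [e])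
    rw [h.compl_adj_iff hik.le (by omega) (by omega), not_not]
    exact hY j (by omega) (by omega)

theorem length_odd_of_far (h : PathAntipath G p q k l) {s t α β : ℕ} (hs : 1 ≤ s) (hst : s + 2 ≤ t)
    (htl : t < l) (hα : α ≤ k) (hβ : β ≤ k) (hαS : CompleteTo G p q s (t - 1) α)
    (hαT : ¬ G.Adj (p α) (q t)) (hβT : CompleteTo G p q (s + 1) t β)
    (hβS : ¬ G.Adj (p β) (q s)) (hαβ : α + 1 < β ∨ β + 1 < α) : (t - s) % 2 = 1 := by
  by_contra hcon
  have hadj := (h.compl_adj_path_iff hα hβ).2 hαβ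
  refine h.not_hasHole_compl (n := t - s + 1 + 2) (by omega) (by omega)
    ((h.spansPath_snoc hs (by omega) htl hα hαS hαT).hasHole (z := p β) (by omega) ?_
      ((h.compl_adj_iff hβ hs (by omega)).2 hβS) hadj ?_)
  · rw [Set.mem_insert_iff, not_or]
    exact ⟨hadj.ne', h.notMem_image hβ hs htl⟩
  · rintro _ (rfl | ⟨j, hj, rfl⟩) hne hne'
    · exact (hne' rfl).elim
    · rw [Set.mem_Icc] at hj
      have h1 : j ≠ s := fun e => hne (by rw [e])
      rw [h.compl_adj_iff hβ (by omega) (by omega), not_not]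
      exact hβT j (by omega) hj.2

theorem length_even_of_near (h : PathAntipath G p q k l) {s t α β ζ : ℕ} (hs : 1 ≤ s) (hst : s < t)
    (htl : t < l) (hα : α ≤ k) (hβ : β ≤ k) (hζ : ζ ≤ k) (hαS : CompleteTo G p q s (t - 1) α)
    (hαT : ¬ G.Adj (p α) (q t)) (hβT : CompleteTo G p q (s + 1) t β)
    (hβS : ¬ G.Adj (p β) (q s)) (hζc : CompleteTo G p q s t ζ)
    (hαβ : β = α + 1 ∨ α = β + 1) (hαζ : α + 1 < ζ ∨ ζ + 1 < α) (hβζ : β + 1 < ζ ∨ ζ + 1 < β) :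
    (t - s) % 2 = 0 := by
  by_contra hcon
  have hadj := (h.compl_adj_path_iff hζ hβ).2 hβζ.symm
  have hαβ' : ¬ Gᶜ.Adj (p α) (p β) := by rw [h.compl_adj_path_iff hα hβ]; omega
  refine h.not_hasHole_compl (n := t - s + 1 + 1 + 2) (by omega) (by omega)
    ((h.spansPath_snoc_snoc hs hst htl hα hαS hαT hζ hζc hαζ).hasHole (z := p β)
      (by omega) ?_ ((h.compl_adj_iff hβ hs (by omega)).2 hβS) hadj ?_)
  · simp only [Set.mem_insert_iff, not_or]
    refine ⟨hadj.ne', fun e => ?_, h.notMem_image hβ hs htl⟩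
    have := (h.path β hβ α hα).2 e
    omega
  · rintro _ (rfl | rfl | ⟨j, hj, rfl⟩) hne hne'
    · exact (hne' rfl).elim
    · exact hαβ'
    · rw [Set.mem_Icc] at hj
      have h1 : j ≠ s := fun e => hne (by rw [e])
      rw [h.compl_adj_iff hβ (by omega) (by omega), not_not]
      exact hβT j (by omega) hj.2

/-- The vertices `p ξ, p α, p β, p ζ` are consecutive in `p`, in one of the two orders. -/
theorem length_odd_of_four (h : PathAntipath G p q k l) {s t α β ζ ξ : ℕ} (hs : 1 ≤ s) (hst : s < t)
    (htl : t < l) (hα : α ≤ k) (hβ : β ≤ k) (hζ : ζ ≤ k) (hξ : ξ ≤ k)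
    (hαS : CompleteTo G p q s (t - 1) α)
    (hαT : ¬ G.Adj (p α) (q t)) (hβT : CompleteTo G p q (s + 1) t β)
    (hβS : ¬ G.Adj (p β) (q s)) (hζc : CompleteTo G p q s t ζ) (hξc : CompleteTo G p q s t ξ)
    (hpos : (α = ξ + 1 ∧ β = ξ + 2 ∧ ζ = ξ + 3) ∨ (ξ = α + 1 ∧ ξ = β + 2 ∧ ξ = ζ + 3)) :
    (t - s) % 2 = 1 := by
  by_contra hcon
  have hζξ := (h.compl_adj_path_iff hζ hξ).2 (by omega)
  have hξβ := (h.compl_adj_path_iff hξ hβ).2 (by omega)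
  have hαβ : ¬ Gᶜ.Adj (p α) (p β) := by rw [h.compl_adj_path_iff hα hβ]; omega
  have hζβ : ¬ Gᶜ.Adj (p ζ) (p β) := by rw [h.compl_adj_path_iff hζ hβ]; omega
  have hαξ : ¬ Gᶜ.Adj (p α) (p ξ) := by rw [h.compl_adj_path_iff hα hξ]; omega
  have hpath : SpansPath Gᶜ (insert (p ξ) (insert (p ζ) (insert (p α) (q '' Set.Icc s t)))) (q s)
      (p ξ) (t - s + 1 + 1 + 1) := by
    refine (h.spansPath_snoc_snoc hs hst htl hα hαS hαT hζ hζc (by omega)).snoc ?_ hζξ ?_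
    · simp only [Set.mem_insert_iff, not_or]
      refine ⟨hζξ.ne', fun e => ?_, h.notMem_image hξ hs htl⟩
      have := (h.path ξ hξ α hα).2 e
      omega
    · rintro _ (rfl | rfl | ⟨j, hj, rfl⟩) hne
      · exact (hne rfl).elim
      · exact hαξ
      · rw [Set.mem_Icc] at hj
        rw [h.compl_adj_iff hξ (by omega) (by omega), not_not]
        exact hξc j hj.1 hj.2
  refine h.not_hasHole_compl (n := t - s + 1 + 1 + 1 + 2) (by omega) (by omega)
    (hpath.hasHole (z := p β) (by omega) ?_ ((h.compl_adj_iff hβ hs (by omega)).2 hβS) hξβ ?_)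
  · simp only [Set.mem_insert_iff, not_or]
    refine ⟨hξβ.ne', fun e => ?_, fun e => ?_, h.notMem_image hβ hs htl⟩
    · have := (h.path β hβ ζ hζ).2 e
      omega
    · have := (h.path β hβ α hα).2 e
      omega
  · rintro _ (rfl | rfl | rfl | ⟨j, hj, rfl⟩) hne hne'
    · exact (hne' rfl).elim
    · exact hζβ
    · exact hαβ
    · rw [Set.mem_Icc] at hj
      have h1 : j ≠ s := fun e => hne (by rw [e])
      rw [h.compl_adj_iff hβ (by omega) (by omega), not_not]
      exact hβT j (by omega) hj.2

theorem hasGoodGaps_single (h : PathAntipath G p q k l) {j : ℕ} (hj : 1 ≤ j) (hjl : j < l) :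
    HasGoodGaps k (fun i => G.Adj (p i) (q j)) := by
  intro i i' hii hik hi hi' hno
  by_contra! hcon
  have hodd : (i' - i) % 2 = 1 := Nat.not_even_iff.1 hcon.2
  refine (h.berge (i' - i + 2) (by omega) (Nat.odd_iff.2 (by omega))).1
    ((h.path.spansPath hii.le hik).hasHole (z := q j) (by omega) ?_ hi hi' ?_)
  · rintro ⟨u, hu, e⟩
    exact h.ne (hu.2.trans hik) hj hjl e
  · rintro _ ⟨u, hu, rfl⟩ hne hne'
    rw [Set.mem_Icc] at hu
    have h1 : u ≠ i := fun e => hne (by rw [e])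
    have h2 : u ≠ i' := fun e => hne' (by rw [e])
    exact hno u (by omega) (by omega)

/-- `x`, `y` are consecutive interior vertices of the antipath, in either order. -/
theorem even_of_alternate (h : PathAntipath G p q k l) {x y i i' : ℕ} (hx : 1 ≤ x) (hxl : x < l)
    (hy : 1 ≤ y) (hyl : y < l) (hxy : x + 1 = y ∨ y + 1 = x) (hii : i < i') (hik : i' ≤ k)
    (hix : G.Adj (p i) (q x)) (hiy : ¬ G.Adj (p i) (q y)) (hix' : ¬ G.Adj (p i') (q x))
    (hiy' : G.Adj (p i') (q y))
    (hno : ∀ u, i < u → u < i' → ¬ G.Adj (p u) (q x) ∧ ¬ G.Adj (p u) (q y)) :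
    Even (i' - i) := by
  by_contra hcon
  rw [Nat.not_even_iff] at hcon
  have h5 := h.five_le_l
  have hi0 : 1 ≤ i := by
    by_contra h0
    obtain rfl : i = 0 := by omega
    exact hiy (h.adj_interior y hy hyl).1
  have hik' : i' < k := by
    by_contra h0
    obtain rfl : i' = k := by omega
    exact hix' (h.adj_interior x hx hxl).2
  have hnxy : ¬ G.Adj (q x) (q y) :=
    (((h.antipath x hxl.le y hyl.le).1.2 hxy)).2
  have hnexy : q x ≠ q y := (((h.antipath x hxl.le y hyl.le).1.2 hxy)).1
  obtain ⟨e, he, heq⟩ : ∃ e, (e = 0 ∨ e = l) ∧ (e + 1 < x ∨ x + 1 < e) ∧ (e + 1 < y ∨ y + 1 < e) := by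
    by_cases hlow : 2 ≤ x ∧ 2 ≤ y
    · exact ⟨0, Or.inl rfl, by omega, by omega⟩
    · exact ⟨l, Or.inr rfl, by omega, by omega⟩
  have hel : e ≤ l := by omega
  have hqe : ∀ z, z ≤ l → (e + 1 < z ∨ z + 1 < e) → G.Adj (q z) (q e) := by
    intro z hz hze
    have := h.antipath z hz e hel
    by_contra hna
    have := this.1.1 ⟨fun e1 => by have := this.2 e1; omega, hna⟩
    omega
  have hpe : ∀ u, 1 ≤ u → u < k → Gᶜ.Adj (p u) (q e) := by
    intro u hu huk
    rcases he with rfl | rfl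
    · exact (h.compl_adj_ends u hu huk).1
    · exact (h.compl_adj_ends u hu huk).2
  have hpath1 : SpansPath G (insert (q y) (p '' Set.Icc i i')) (p i) (q y) (i' - i + 1) := by
    refine (h.path.spansPath hii.le hik).snoc ?_ hiy' ?_
    · rintro ⟨u, hu, e⟩
      exact h.ne (hu.2.trans hik) hy hyl e
    · rintro _ ⟨u, hu, rfl⟩ hne
      rw [Set.mem_Icc] at hu
      have h2 : u ≠ i' := fun e => hne (by rw [e])
      rcases Nat.eq_or_lt_of_le hu.1 with rfl | h1
      · exact hiy
      · exact (hno u h1 (by omega)).2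
  have hye := hqe y hyl.le heq.2
  have hxe := hqe x hxl.le heq.1
  have hpath2 : SpansPath G (insert (q e) (insert (q y) (p '' Set.Icc i i'))) (p i) (q e)
      (i' - i + 1 + 1) := by
    refine hpath1.snoc ?_ hye ?_
    · rintro (e1 | ⟨u, hu, e1⟩)
      · exact hye.ne' e1
      · exact (hpe u (hi0.trans hu.1) (hu.2.trans_lt hik')).ne e1
    · rintro _ (rfl | ⟨u, hu, rfl⟩) hne
      · exact (hne rfl).elim
      · exact (hpe u (hi0.trans hu.1) (hu.2.trans_lt hik')).2
  refine (h.berge (i' - i + 1 + 1 + 2) (by omega) (Nat.odd_iff.2 (by omega))).1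
    (hpath2.hasHole (z := q x) (by omega) ?_ hix hxe.symm ?_)
  · rintro (e1 | e1 | ⟨u, hu, e1⟩)
    · exact hxe.ne e1
    · exact hnexy e1
    · exact h.ne (hu.2.trans hik) hx hxl e1
  · rintro _ (rfl | rfl | ⟨u, hu, rfl⟩) hne hne'
    · exact (hne' rfl).elim
    · exact fun h' => hnxy h'.symm
    · rw [Set.mem_Icc] at hu
      have h1 : u ≠ i := fun e => hne (by rw [e])
      rcases Nat.eq_or_lt_of_le hu.2 with rfl | h2
      · exact hix'
      · exact (hno u (by omega) h2).1

theorem completeTo_split {s t i : ℕ} (hst : s < t) :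
    CompleteTo G p q s t i ↔ CompleteTo G p q s (t - 1) i ∧ CompleteTo G p q (s + 1) t i := by
  refine ⟨fun h => ⟨fun j h1 h2 => h j h1 (by omega), fun j h1 h2 => h j (by omega) h2⟩,
    fun h j h1 h2 => ?_⟩
  rcases Nat.lt_or_ge j t with h3 | h3
  · exact h.1 j h1 (by omega)
  · exact h.2 j (by omega) h2

theorem not_adj_last {s t i : ℕ} (hS : CompleteTo G p q s (t - 1) i)
    (hT : ¬ CompleteTo G p q (s + 1) t i) : ¬ G.Adj (p i) (q t) := by
  intro hadj
  refine hT fun j h1 h2 => ?_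
  rcases Nat.lt_or_ge j t with h3 | h3
  · exact hS j (by omega) (by omega)
  · rwa [show j = t by omega]

theorem not_adj_first {s t i : ℕ} (hst : s < t) (hT : CompleteTo G p q (s + 1) t i)
    (hS : ¬ CompleteTo G p q s (t - 1) i) : ¬ G.Adj (p i) (q s) := by
  intro hadj
  refine hS fun j h1 h2 => ?_
  rcases Nat.lt_or_ge s j with h3 | h3
  · exact hT j (by omega) (by omega)
  · rwa [show j = s by omega]

theorem even_of_complete_swap (h : PathAntipath G p q k l) {s t α β : ℕ} (hs : 1 ≤ s)
    (hst : s + 3 ≤ t) (htl : t < l) (hpar : (t - s) % 2 = 1)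
    (hY : HasGoodGaps k (CompleteTo G p q (s + 1) (t - 1)))
    (hα : α ≤ k) (hβ : β ≤ k) (hαS : CompleteTo G p q s (t - 1) α)
    (hαT : ¬ CompleteTo G p q (s + 1) t α) (hβT : CompleteTo G p q (s + 1) t β)
    (hβS : ¬ CompleteTo G p q s (t - 1) β)
    (hno : ∀ u, min α β < u → u < max α β →
      ¬ CompleteTo G p q s (t - 1) u ∧ ¬ CompleteTo G p q (s + 1) t u) :
    Even (max α β - min α β) := by
  have h5 := h.five_le_k
  have hαT' := not_adj_last hαS hαT
  have hβS' := not_adj_first (by omega) hβT hβS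
  have hne : α ≠ β := fun e => hβS (e ▸ hαS)
  have hα0 : α ≠ 0 := by
    rintro rfl
    exact hαT' (h.adj_interior t (by omega) htl).1
  have hβ0 : β ≠ 0 := by
    rintro rfl
    exact hβS' (h.adj_interior s (by omega) (by omega)).1
  have hnear : ¬ (β = α + 1 ∨ α = β + 1) := by
    intro hn
    obtain ⟨ζ, hζ, h1, h2⟩ : ∃ ζ, (ζ = 0 ∨ ζ = k) ∧ (α + 1 < ζ ∨ ζ + 1 < α) ∧
        (β + 1 < ζ ∨ ζ + 1 < β) := by
      by_cases hlow : 2 ≤ α ∧ 2 ≤ β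
      · exact ⟨0, Or.inl rfl, by omega, by omega⟩
      · exact ⟨k, Or.inr rfl, by omega, by omega⟩
    have := h.length_even_of_near hs (by omega) htl hα hβ (show ζ ≤ k by omega) hαS hαT' hβT hβS'
      (fun j h1 h2 => by
        rcases hζ with rfl | rfl
        · exact (h.adj_interior j (by omega) (by omega)).1
        · exact (h.adj_interior j (by omega) (by omega)).2) hn h1 h2
    omega
  have hαY : CompleteTo G p q (s + 1) (t - 1) α := fun j h1 h2 => hαS j (by omega) h2
  have hβY : CompleteTo G p q (s + 1) (t - 1) β := fun j h1 h2 => hβT j h1 (by omega)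
  have hmin : CompleteTo G p q (s + 1) (t - 1) (min α β) := by
    rcases min_choice α β with e | e <;> rw [e] <;> assumption
  have hmax : CompleteTo G p q (s + 1) (t - 1) (max α β) := by
    rcases max_choice α β with e | e <;> rw [e] <;> assumption
  refine (hY (min α β) (max α β) (by omega) (by omega) hmin hmax fun u h1 h2 hu => ?_).resolve_left
    (by omega)
  have hus : ¬ G.Adj (p u) (q s) := fun hadj => (hno u h1 h2).1 fun j g1 g2 => by
    rcases Nat.lt_or_ge s j with h3 | h3
    · exact hu j (by omega) (by omega)
    · rwa [show j = s by omega]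
  have hut : ¬ G.Adj (p u) (q t) := fun hadj => (hno u h1 h2).2 fun j g1 g2 => by
    rcases Nat.lt_or_ge j t with h3 | h3
    · exact hu j (by omega) (by omega)
    · rwa [show j = t by omega]
  have := h.length_even_of_misses_both hst htl.le (show u < k by omega)
    ((h.compl_adj_iff (by omega) (by omega) (by omega)).2 hus)
    ((h.compl_adj_iff (by omega) (by omega) (by omega)).2 hut) hu
  omega

theorem hasGoodGaps (h : PathAntipath G p q k l) (d : ℕ) :
    ∀ s, 1 ≤ s → s + d < l → HasGoodGaps k (CompleteTo G p q s (s + d)) := by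
  have hsingle : ∀ j i, CompleteTo G p q j j i ↔ G.Adj (p i) (q j) := fun j i =>
    ⟨fun hj => hj j le_rfl le_rfl, fun hj u h1 h2 => by rwa [show u = j by omega]⟩
  induction d using Nat.strong_induction_on with
  | _ d ih =>
    intro s hs hsl
    rcases Nat.eq_zero_or_pos d with rfl | hd
    · simp only [Nat.add_zero]
      rw [show CompleteTo G p q s s = fun i => G.Adj (p i) (q s) from
        funext fun i => propext (hsingle s i)]
      exact h.hasGoodGaps_single hs hsl
    obtain ⟨t, ht⟩ : ∃ t, t = s + d := ⟨_, rfl⟩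
    have hst : s < t := by omega
    rw [← ht] at hsl ⊢
    rw [show CompleteTo G p q s t = fun i => CompleteTo G p q s (t - 1) i ∧
      CompleteTo G p q (s + 1) t i from funext fun i => propext (completeTo_split hst)]
    have hS : HasGoodGaps k (CompleteTo G p q s (t - 1)) := by
      have := ih (d - 1) (by omega) s hs (by omega)
      rwa [show s + (d - 1) = t - 1 by omega] at this
    have hT : HasGoodGaps k (CompleteTo G p q (s + 1) t) := by
      have := ih (d - 1) (by omega) (s + 1) (by omega) (by omega)
      rwa [show s + 1 + (d - 1) = t by omega] at this
    rcases Nat.mod_two_eq_zero_or_one (t - s) with hpar | hpar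
    · refine hS.and_of_odd hT (fun i i' hi hi' h1 h2 h3 h4 => ?_) (fun i hi h1 h2 h3 h4 => ?_)
      · by_contra hcon
        have hne : i ≠ i' := fun e => h4 (e ▸ h1)
        have := h.length_odd_of_far hs (by omega) hsl hi hi' h1 (not_adj_last h1 h2) h3
          (not_adj_first hst h3 h4) (by omega)
        omega
      · have c1 := (completeTo_split hst).2 ⟨h1, h2⟩
        have c2 := (completeTo_split hst).2 ⟨h3, h4⟩
        constructor
        · rintro ⟨g1, g2, g3, g4⟩
          have := h.length_odd_of_four hs hst hsl (by omega) (by omega) hi (by omega) g1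
            (not_adj_last g1 g2) g3 (not_adj_first hst g3 g4) c2 c1 (by omega)
          omega
        · rintro ⟨g1, g2, g3, g4⟩
          have := h.length_odd_of_four hs hst hsl (by omega) (by omega) (by omega) hi g3
            (not_adj_last g3 g4) g1 (not_adj_first hst g1 g2) c1 c2 (by omega)
          omega
    · refine hS.and_of_even hT fun i i' hii hik hcase hno => ?_
      by_cases hd1 : t = s + 1
      · subst hd1
        simp only [Nat.add_sub_cancel, hsingle] at hcase hno
        rcases hcase with ⟨h1, h2, h3, h4⟩ | ⟨h1, h2, h3, h4⟩
        · exact h.even_of_alternate hs (by omega) (by omega) hsl (Or.inl rfl) hii hik h1 h2 h4 h3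
            hno
        · exact h.even_of_alternate (by omega) hsl hs (by omega) (Or.inr rfl) hii hik h1 h2 h4 h3
            fun u g1 g2 => (hno u g1 g2).symm
      · have hY : HasGoodGaps k (CompleteTo G p q (s + 1) (t - 1)) := by
          have := ih (d - 2) (by omega) (s + 1) (by omega) (by omega)
          rwa [show s + 1 + (d - 2) = t - 1 by omega] at this
        rcases hcase with ⟨h1, h2, h3, h4⟩ | ⟨h1, h2, h3, h4⟩
        · have := h.even_of_complete_swap hs (by omega) hsl hpar hY (by omega) hik h1 h2 h3 h4
            (fun u g1 g2 => hno u (by omega) (by omega))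
          rwa [max_eq_right hii.le, min_eq_left hii.le] at this
        · have := h.even_of_complete_swap hs (by omega) hsl hpar hY hik (by omega) h3 h4 h1 h2
            (fun u g1 g2 => hno u (by omega) (by omega))
          rwa [max_eq_left hii.le, min_eq_right hii.le] at this

theorem not_pathAntipath : ¬ PathAntipath G p q k l := by
  intro h
  have hl5 := h.five_le_l
  have hk5 := h.five_le_k
  have hodd := Nat.odd_iff.1 h.odd_l
  have hgaps := h.hasGoodGaps (l - 2) 1 le_rfl (by omega)
  rw [show 1 + (l - 2) = l - 1 by omega] at hgaps
  obtain ⟨u, hu0, huk, hu⟩ := hgaps.exists_mem h.odd_k (by omega)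
    (fun j h1 h2 => (h.adj_interior j h1 (by omega)).1)
    (fun j h1 h2 => (h.adj_interior j h1 (by omega)).2)
  have hends := h.compl_adj_ends u hu0 huk
  have := h.length_even_of_misses_both (s := 0) (t := l) (by omega) le_rfl huk hends.1.symm
    hends.2.symm hu
  omega

end PathAntipath

/-- `a, b, c, d` are the vertices in order of an induced path of `H` on four vertices. -/
def IsInducedPathFour {V : Type} (H : SimpleGraph V) (a b c d : V) : Prop :=
  H.Adj a b ∧ H.Adj b c ∧ H.Adj c d ∧ Hᶜ.Adj b d ∧ Hᶜ.Adj d a ∧ Hᶜ.Adj a c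

open Fin.CommRing in
/-- Going around a hole containing the path `a, b, c, d`, starting with `b, c, d` and ending
in `a`. -/
theorem exists_cyclic_labelling {V : Type} {H : SimpleGraph V} {m : ℕ} (hm : 5 ≤ m)
    (f : cycleGraph m ↪g H) {a b c d : V} (ha : a ∈ Set.range f) (hb : b ∈ Set.range f)
    (hc : c ∈ Set.range f) (hd : d ∈ Set.range f) (hab : H.Adj a b) (hbc : H.Adj b c)
    (hcd : H.Adj c d) (hac : a ≠ c) (hbd : b ≠ d) :
    ∃ P : ℕ → V, P 0 = b ∧ P 1 = c ∧ P 2 = d ∧ P (m - 1) = a ∧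
      ∀ u < m, ∀ v < m, (H.Adj (P u) (P v) ↔ u + 1 = v ∨ v + 1 = u ∨
        (u = 0 ∧ v + 1 = m) ∨ (v = 0 ∧ u + 1 = m)) ∧ (P u = P v → u = v) := by
  obtain ⟨N, rfl⟩ : ∃ N, m = N + 2 := ⟨m - 2, by omega⟩
  obtain ⟨a, rfl⟩ := ha
  obtain ⟨b, rfl⟩ := hb
  obtain ⟨c, rfl⟩ := hc
  obtain ⟨d, rfl⟩ := hd
  rw [f.map_adj_iff, cycleGraph_adj] at hab hbc hcd
  have hac' : a ≠ c := fun e => hac (by rw [e])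
  have hbd' : b ≠ d := fun e => hbd (by rw [e])
  obtain ⟨ε, hε, hcε, haε, hdε⟩ : ∃ ε : Fin (N + 2), (ε = 1 ∨ ε = -1) ∧ c = b + ε ∧ a = b - ε ∧
      d = c + ε := by
    rcases hbc with h | h
    · refine ⟨-1, Or.inr rfl, by rw [← h]; abel, ?_, ?_⟩
      · rcases hab with h' | h'
        · rw [← h']; abel
        · exact (hac' (by rw [← sub_right_inj (a := b), h, h'])).elim
      · rcases hcd with h' | h'
        · rw [← h']; abel
        · exact (hbd' (by rw [← sub_left_inj (a := c), h, h'])).elim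
    · refine ⟨1, Or.inl rfl, by rw [← h]; abel, ?_, ?_⟩
      · rcases hab with h' | h'
        · exact (hac' (by rw [← sub_left_inj (a := b), h, h'])).elim
        · rw [← h']; abel
      · rcases hcd with h' | h'
        · exact (hbd' (by rw [← sub_right_inj (a := c), h, h'])).elim
        · rw [← h']; abel
  have hcast : (Nat.cast (N + 2) : Fin (N + 2)) = 0 := Fin.natCast_self _
  have hval : ∀ u < N + 2, ((u : ℕ) : Fin (N + 2)).val = u := fun u hu => Fin.val_cast_of_lt hu
  refine ⟨fun u => f (b + ε * (u : Fin (N + 2))), by simp, by simp [hcε], ?_, ?_,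
    fun u hu v hv => ⟨?_, fun e => ?_⟩⟩
  · simp only [hdε, hcε]
    congr 1
    push_cast
    ring
  · simp only [haε]
    congr 1
    have : ((N + 2 - 1 : ℕ) : Fin (N + 2)) = -1 := by
      rw [eq_neg_iff_add_eq_zero, ← hcast]
      push_cast [show N + 2 - 1 = N + 1 by omega]
      ring
    rw [this]
    ring
  · rw [f.map_adj_iff]
    have : (cycleGraph (N + 2)).Adj (b + ε * (u : Fin (N + 2))) (b + ε * (v : Fin (N + 2))) ↔
        (cycleGraph (N + 2)).Adj (u : Fin (N + 2)) (v : Fin (N + 2)) := by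
      rw [cycleGraph_adj, cycleGraph_adj]
      rcases hε with rfl | rfl
      · simp
      · rw [or_comm]
        simp [← sub_eq_add_neg]
    rw [this, cycleGraph_adj_iff_val (by omega), hval u hu, hval v hv]
  · have e1 := add_left_cancel (f.injective e)
    have e2 : (u : Fin (N + 2)) = v := by
      rcases hε with rfl | rfl
      · simpa using e1
      · simpa using e1
    rw [← hval u hu, ← hval v hv, e2]

theorem not_isInducedPathFour {V : Type} {G : SimpleGraph V} (hG : IsBerge G) {m n : ℕ}
    (hm : 8 ≤ m) (hn : 8 ≤ n) (f : cycleGraph m ↪g G) (g : cycleGraph n ↪g Gᶜ) {a b c d : V}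
    (hf : ∀ x ∈ ({a, b, c, d} : Set V), x ∈ Set.range f)
    (hg : ∀ x ∈ ({a, b, c, d} : Set V), x ∈ Set.range g) : ¬ IsInducedPathFour G a b c d := by
  rintro ⟨hab, hbc, hcd, hbd, hda, hac⟩
  have hmeven : m % 2 = 0 := by
    by_contra hodd
    exact (hG m (by omega) (Nat.odd_iff.2 (by omega))).1 ⟨f⟩
  have hneven : n % 2 = 0 := by
    by_contra hodd
    exact (hG n (by omega) (Nat.odd_iff.2 (by omega))).2 ⟨g⟩
  obtain ⟨P, hP0, hP1, hP2, hPl, hP⟩ := exists_cyclic_labelling (by omega) f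
    (hf a (by simp)) (hf b (by simp)) (hf c (by simp)) (hf d (by simp)) hab hbc hcd hac.ne hbd.ne
  obtain ⟨Q, hQ0, hQ1, hQ2, hQl, hQ⟩ := exists_cyclic_labelling (by omega) g
    (hg b (by simp)) (hg d (by simp)) (hg a (by simp)) (hg c (by simp)) hbd hda hac hab.ne'
    hcd.ne'
  have hk : 2 + (m - 3) = m - 1 := by omega
  have hl : 2 + (n - 3) = n - 1 := by omega
  have hadjQ : ∀ u < n, ∀ v, 2 < v → v < n - 1 → u < 2 → G.Adj (Q u) (Q v) := by
    intro u hu v hv hvn hu2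
    by_contra hna
    have := hQ u hu v (by omega)
    have := this.1.1 ⟨fun e => by have := this.2 e; omega, hna⟩
    omega
  have hadjP : ∀ u < m, ∀ v, 2 < v → v < m - 1 → u < 2 → Gᶜ.Adj (P v) (P u) := by
    intro u hu v hv hvm hu2
    have := hP v (by omega) u hu
    rw [compl_adj, this.1]
    exact ⟨fun e => by have := this.2 e; omega, by omega⟩
  refine PathAntipath.not_pathAntipath (G := G) (p := fun u => P (2 + u)) (q := fun u => Q (2 + u))
    (k := m - 3) (l := n - 3) ⟨hG, Nat.odd_iff.2 (by omega), Nat.odd_iff.2 (by omega), by omega,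
      by omega, fun u hu v hv => ?_, fun u hu v hv => ?_, fun j hj hjl => ?_, fun i hi hik => ?_⟩
  · have := hP (2 + u) (by omega) (2 + v) (by omega)
    exact ⟨by rw [this.1]; omega, fun e => by have := this.2 e; omega⟩
  · have := hQ (2 + u) (by omega) (2 + v) (by omega)
    exact ⟨by rw [this.1]; omega, fun e => by have := this.2 e; omega⟩
  · simp only [hk, Nat.add_zero]
    rw [hP2, hPl, ← hQ0, ← hQ1]
    exact ⟨hadjQ 0 (by omega) _ (by omega) (by omega) (by omega),
      hadjQ 1 (by omega) _ (by omega) (by omega) (by omega)⟩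
  · simp only [hl, Nat.add_zero]
    rw [hQ2, hQl, ← hP0, ← hP1]
    exact ⟨hadjP 1 (by omega) _ (by omega) (by omega) (by omega),
      hadjP 0 (by omega) _ (by omega) (by omega) (by omega)⟩

theorem not_triangle_of_cycleGraph_embedding {V : Type} {H : SimpleGraph V} {m : ℕ} (hm : 5 ≤ m)
    (f : cycleGraph m ↪g H) {x y z : V} (hx : x ∈ Set.range f) (hy : y ∈ Set.range f)
    (hz : z ∈ Set.range f) : ¬ (H.Adj x y ∧ H.Adj y z ∧ H.Adj x z) := by
  obtain ⟨x, rfl⟩ := hx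
  obtain ⟨y, rfl⟩ := hy
  obtain ⟨z, rfl⟩ := hz
  simp only [f.map_adj_iff, cycleGraph_adj_iff_val (show 3 ≤ m by omega)]
  omega

theorem not_square_of_cycleGraph_embedding {V : Type} {H : SimpleGraph V} {m : ℕ} (hm : 5 ≤ m)
    (f : cycleGraph m ↪g H) {w x y z : V} (hw : w ∈ Set.range f) (hx : x ∈ Set.range f)
    (hy : y ∈ Set.range f) (hz : z ∈ Set.range f) (hwy : w ≠ y) (hxz : x ≠ z) :
    ¬ (H.Adj w x ∧ H.Adj x y ∧ H.Adj y z ∧ H.Adj w z) := by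
  obtain ⟨w, rfl⟩ := hw
  obtain ⟨x, rfl⟩ := hx
  obtain ⟨y, rfl⟩ := hy
  obtain ⟨z, rfl⟩ := hz
  have hwy' : w.val ≠ y.val := fun e => hwy (by rw [Fin.ext e])
  have hxz' : x.val ≠ z.val := fun e => hxz (by rw [Fin.ext e])
  simp only [f.map_adj_iff, cycleGraph_adj_iff_val (show 3 ≤ m by omega)]
  omega

/-- A symmetric relation on four points such that neither it nor its complement has a triangle or
a four-cycle is a path. -/
theorem exists_path_of_fin_four {A : Fin 4 → Fin 4 → Prop} (hs : ∀ i j, A i j ↔ A j i)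
    (h3 : ∀ i j k, ¬ (A i j ∧ A j k ∧ A i k))
    (hc3 : ∀ i j k, i ≠ j → j ≠ k → i ≠ k → A i j ∨ A j k ∨ A i k)
    (h4 : ∀ i j k l, i ≠ k → j ≠ l → ¬ (A i j ∧ A j k ∧ A k l ∧ A i l))
    (hc4 : ∀ i j k l, i ≠ j → j ≠ k → k ≠ l → i ≠ l → i ≠ k → j ≠ l →
      A i j ∨ A j k ∨ A k l ∨ A i l) :
    ∃ i j k l, A i j ∧ A j k ∧ A k l ∧ (j ≠ l ∧ ¬ A j l) ∧ (l ≠ i ∧ ¬ A l i) ∧ i ≠ k ∧ ¬ A i k := by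
  by_contra hno
  have hP : ∀ i j k l, j ≠ l → l ≠ i → i ≠ k →
      ¬ (A i j ∧ A j k ∧ A k l ∧ ¬ A j l ∧ ¬ A l i ∧ ¬ A i k) :=
    fun i j k l n1 n2 n3 ⟨e1, e2, e3, e4, e5, e6⟩ =>
      hno ⟨i, j, k, l, e1, e2, e3, ⟨n1, e4⟩, ⟨n2, e5⟩, n3, e6⟩
  have := h3 0 1 2
  have := hc3 0 1 2 (by decide) (by decide) (by decide)
  have := h3 0 1 3
  have := hc3 0 1 3 (by decide) (by decide) (by decide)
  have := h3 0 2 3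
  have := hc3 0 2 3 (by decide) (by decide) (by decide)
  have := h3 1 2 3
  have := hc3 1 2 3 (by decide) (by decide) (by decide)
  have := h4 0 1 2 3 (by decide) (by decide)
  have := hc4 0 1 2 3 (by decide) (by decide) (by decide) (by decide) (by decide) (by decide)
  have := h4 0 1 3 2 (by decide) (by decide)
  have := hc4 0 1 3 2 (by decide) (by decide) (by decide) (by decide) (by decide) (by decide)
  have := h4 0 2 1 3 (by decide) (by decide)
  have := hc4 0 2 1 3 (by decide) (by decide) (by decide) (by decide) (by decide) (by decide)
  have := hP 0 1 2 3 (by decide) (by decide) (by decide)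
  have := hP 0 1 3 2 (by decide) (by decide) (by decide)
  have := hP 0 2 1 3 (by decide) (by decide) (by decide)
  have := hP 0 2 3 1 (by decide) (by decide) (by decide)
  have := hP 0 3 1 2 (by decide) (by decide) (by decide)
  have := hP 0 3 2 1 (by decide) (by decide) (by decide)
  have := hP 1 0 2 3 (by decide) (by decide) (by decide)
  have := hP 1 0 3 2 (by decide) (by decide) (by decide)
  have := hP 1 2 0 3 (by decide) (by decide) (by decide)
  have := hP 1 3 0 2 (by decide) (by decide) (by decide)
  have := hP 2 0 1 3 (by decide) (by decide) (by decide)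
  have := hP 2 1 0 3 (by decide) (by decide) (by decide)
  have := hs 0 1
  have := hs 0 2
  have := hs 0 3
  have := hs 1 2
  have := hs 1 3
  have := hs 2 3
  clear h3 hc3 h4 hc4 hP hno hs
  grind

/-- On four vertices, a graph such that neither it nor its complement has a triangle or a
four-cycle is a path. -/
theorem exists_isInducedPathFour {V : Type} {G : SimpleGraph V} {e : Fin 4 → V}
    (he : Function.Injective e)
    (hG3 : ∀ i j k, ¬ (G.Adj (e i) (e j) ∧ G.Adj (e j) (e k) ∧ G.Adj (e i) (e k)))
    (hGc3 : ∀ i j k, ¬ (Gᶜ.Adj (e i) (e j) ∧ Gᶜ.Adj (e j) (e k) ∧ Gᶜ.Adj (e i) (e k)))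
    (hG4 : ∀ i j k l, i ≠ k → j ≠ l → ¬ (G.Adj (e i) (e j) ∧ G.Adj (e j) (e k) ∧
      G.Adj (e k) (e l) ∧ G.Adj (e i) (e l)))
    (hGc4 : ∀ i j k l, i ≠ k → j ≠ l → ¬ (Gᶜ.Adj (e i) (e j) ∧ Gᶜ.Adj (e j) (e k) ∧
      Gᶜ.Adj (e k) (e l) ∧ Gᶜ.Adj (e i) (e l))) :
    ∃ i j k l, IsInducedPathFour G (e i) (e j) (e k) (e l) := by
  obtain ⟨i, j, k, l, h⟩ := exists_path_of_fin_four (A := fun i j => G.Adj (e i) (e j))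
    (fun i j => G.adj_comm _ _) hG3
    (fun i j k h1 h2 h3 => by
      have := hGc3 i j k
      simp only [compl_adj, he.ne_iff] at this
      tauto) hG4
    (fun i j k l h1 h2 h3 h4 h5 h6 => by
      have := hGc4 i j k l h5 h6
      simp only [compl_adj, he.ne_iff] at this
      tauto)
  exact ⟨i, j, k, l, by simpa only [IsInducedPathFour, compl_adj, he.ne_iff] using h⟩

/-- In a Berge graph, a hole on at least 8 vertices and an antihole on at least
8 vertices share at most 3 vertices. -/
theorem hole_antihole_intersection {V : Type} [Fintype V] (G : SimpleGraph V)
    (hG : IsBerge G) (m n : ℕ) (hm : 8 ≤ m) (hn : 8 ≤ n)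
    (f : cycleGraph m ↪g G) (g : cycleGraph n ↪g Gᶜ) :
    (Set.range (fun i => (f i : V)) ∩ Set.range (fun j => (g j : V))).ncard ≤ 3 := by
  classical
  by_contra! hcard
  rw [← Nat.card_coe_set_eq, Nat.card_eq_fintype_card] at hcard
  obtain ⟨e'⟩ := Function.Embedding.nonempty_of_card_le (α := Fin 4)
    (β := ↥(Set.range (fun i => (f i : V)) ∩ Set.range (fun j => (g j : V))))
    (by rw [Fintype.card_fin]; exact hcard)
  have hf : ∀ i, (e' i : V) ∈ Set.range f := fun i => (e' i).2.1
  have hg : ∀ i, (e' i : V) ∈ Set.range g := fun i => (e' i).2.2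
  have he : Function.Injective fun i => (e' i : V) := Subtype.val_injective.comp e'.injective
  obtain ⟨i, j, k, l, hP⟩ := exists_isInducedPathFour he
    (fun i j k => not_triangle_of_cycleGraph_embedding (by omega) f (hf i) (hf j) (hf k))
    (fun i j k => not_triangle_of_cycleGraph_embedding (by omega) g (hg i) (hg j) (hg k))
    (fun i j k l hik hjl => not_square_of_cycleGraph_embedding (by omega) f (hf i) (hf j) (hf k)
      (hf l) (he.ne hik) (he.ne hjl))
    (fun i j k l hik hjl => not_square_of_cycleGraph_embedding (by omega) g (hg i) (hg j) (hg k)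
      (hg l) (he.ne hik) (he.ne hjl))
  refine not_isInducedPathFour hG hm hn f g ?_ ?_ hP
  · rintro x (rfl | rfl | rfl | rfl) <;> exact hf _
  · rintro x (rfl | rfl | rfl | rfl) <;> exact hg _
end

section
/- In a Berge graph G, let K be a prism with triangles {a1, a2, a3} and {b1, b2, b3} and chordless paths Pi from ai to bi (i = 1, 2, 3), each of length at least 2. Let Y be an anticonnected set of vertices of G, disjoint from V(K), such that every vertex of Y has at least two neighbours in {a1, a2, a3} and at least two neighbours in {b1, b2, b3}. Then at least two members of {a1, a2, a3} are Y-complete and at least two members of {b1, b2, b3} are Y-complete. -/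
open SimpleGraph

/-- `T` is anticonnected: the subgraph of the complement induced on `T` is connected. -/
def Anticonnected {V : Type} (G : SimpleGraph V) (T : Set V) : Prop :=
  (Gᶜ.induce T).Connected

/-- `v` is `T`-complete: `v ∉ T` and `v` is adjacent to every vertex of `T`. -/
def IsTComplete {V : Type} (G : SimpleGraph V) (T : Set V) (v : V) : Prop :=
  v ∉ T ∧ ∀ t ∈ T, G.Adj v t

/-- A prism in `G`: three vertex-disjoint chordless paths (given by embeddings
`f i` of path graphs on `n i ≥ 2` vertices), the path `f i` going from `a i`
to `b i`, such that `{a 0, a 1, a 2}` and `{b 0, b 1, b 2}` are triangles and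
there are no other edges between the paths. -/
def IsPrismConfig {V : Type} (G : SimpleGraph V) (n : Fin 3 → ℕ)
    (f : ∀ i, pathGraph (n i) ↪g G) (a b : Fin 3 → V) : Prop :=
  (∀ i, 2 ≤ n i) ∧
  (∀ i (h : 0 < n i), (f i ⟨0, h⟩ : V) = a i) ∧
  (∀ i (h : n i - 1 < n i), (f i ⟨n i - 1, h⟩ : V) = b i) ∧
  (∀ i j, i ≠ j → ∀ x y, (f i x : V) ≠ f j y) ∧
  (∀ i j, i ≠ j → G.Adj (a i) (a j)) ∧
  (∀ i j, i ≠ j → G.Adj (b i) (b j)) ∧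
  (∀ i j, i ≠ j → ∀ x y, G.Adj (f i x) (f j y) →
    ((f i x : V) = a i ∧ (f j y : V) = a j) ∨ ((f i x : V) = b i ∧ (f j y : V) = b j))

section

variable {V : Type} {G : SimpleGraph V}

/-- The vertices `c 0, …, c N` form a chordless path, in this order. -/
def IndPath (G : SimpleGraph V) (c : ℕ → V) (N : ℕ) : Prop :=
  ∀ i j, i < j → j ≤ N → c i ≠ c j ∧ (G.Adj (c i) (c j) ↔ j = i + 1)

/-- The vertices `c 0, …, c (L - 1)`, followed by `c L = c 0`, form a chordless cycle. -/
def IndCycle (G : SimpleGraph V) (c : ℕ → V) (L : ℕ) : Prop :=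
  c L = c 0 ∧ ∀ i j, i < j → j < L →
    c i ≠ c j ∧ (G.Adj (c i) (c j) ↔ j = i + 1 ∨ (i = 0 ∧ j + 1 = L))

/-- The vertex `v` is off the sequence `c 0, …, c K`, and `c s` is its only neighbour there. -/
def AttachedAt (G : SimpleGraph V) (c : ℕ → V) (K s : ℕ) (v : V) : Prop :=
  ∀ t ≤ K, v ≠ c t ∧ (G.Adj v (c t) ↔ t = s)

/-- The vertex `v` is adjacent to all of `y 0, …, y K`. -/
def SeqComplete (G : SimpleGraph V) (y : ℕ → V) (K : ℕ) (v : V) : Prop :=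
  ∀ t ≤ K, G.Adj v (y t)

lemma IsBerge.compl (hG : IsBerge G) : IsBerge Gᶜ := fun n h5 hn => by
  have := hG n h5 hn
  rw [compl_compl]
  exact ⟨this.2, this.1⟩

lemma IndCycle.even (hG : IsBerge G) {c : ℕ → V} {L : ℕ} (h : IndCycle G c L) (hL : 5 ≤ L) :
    Even L := by
  by_contra hodd
  have hL0 : NeZero L := ⟨by omega⟩
  refine (hG L hL (Nat.not_even_iff_odd.1 hodd)).1 ⟨⟨⟨fun i => c i, ?_⟩, ?_⟩⟩
  · intro i j hij
    by_contra hne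
    rcases lt_or_gt_of_ne hne with hlt | hlt
    · exact (h.2 i j hlt j.2).1 hij
    · exact (h.2 j i hlt i.2).1 hij.symm
  · have key : ∀ i j : Fin L, i < j → (G.Adj (c i) (c j) ↔ (cycleGraph L).Adj i j) := by
      intro i j hlt
      have h1 : ((i : ℕ) : ℕ) < j := hlt
      have hj := j.2
      rw [(h.2 i j hlt j.2).2, cycleGraph_adj', Fin.coe_sub_iff_le.2 hlt.le,
        Fin.coe_sub_iff_lt.2 hlt]
      omega
    intro i j
    change G.Adj (c i) (c j) ↔ _
    rcases lt_trichotomy i j with hlt | heq | hlt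
    · exact key i j hlt
    · subst heq; simp
    · rw [G.adj_comm, (cycleGraph L).adj_comm]; exact key j i hlt

lemma IndCycle.reverse {c : ℕ → V} {L : ℕ} (h : IndCycle G c L) :
    IndCycle G (fun t => c (L - t)) L := by
  refine ⟨by simp [h.1], fun i j hij hj => ?_⟩
  dsimp only
  rcases Nat.eq_zero_or_pos i with rfl | hi
  · have := h.2 0 (L - j) (by omega) (by omega)
    rw [Nat.sub_zero, h.1, this.2]
    exact ⟨this.1, by omega⟩
  · have := h.2 (L - j) (L - i) (by omega) (by omega)
    rw [G.adj_comm, this.2]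
    exact ⟨this.1.symm, by omega⟩

lemma IndPath.mono {c : ℕ → V} {N M : ℕ} (h : IndPath G c N) (hM : M ≤ N) : IndPath G c M :=
  fun i j hij hj => h i j hij (hj.trans hM)

lemma IndPath.shift {c : ℕ → V} {N : ℕ} (h : IndPath G c N) (s M : ℕ) (hM : M + s ≤ N) :
    IndPath G (fun t => c (t + s)) M := fun i j hij hj => by
  have := h (i + s) (j + s) (by omega) (by omega)
  rw [this.2]
  exact ⟨this.1, by omega⟩

lemma IndPath.reverse {c : ℕ → V} {N : ℕ} (h : IndPath G c N) :
    IndPath G (fun t => c (N - t)) N := fun i j hij hj => by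
  have := h (N - j) (N - i) (by omega) (by omega)
  rw [G.adj_comm, this.2]
  exact ⟨this.1.symm, by omega⟩

lemma IndPath.snoc {c : ℕ → V} {N : ℕ} (h : IndPath G c N) {v : V}
    (hv : AttachedAt G c N N v) : IndPath G (fun t => if t ≤ N then c t else v) (N + 1) := by
  intro i j hij hj
  dsimp only
  rw [if_pos (by omega : i ≤ N)]
  split_ifs with hjN
  · exact h i j hij hjN
  · have := hv i (by omega)
    rw [G.adj_comm, this.2]
    exact ⟨this.1.symm, by omega⟩

lemma IndPath.cons {c : ℕ → V} {N : ℕ} (h : IndPath G c N) {v : V}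
    (hv : AttachedAt G c N 0 v) : IndPath G (fun t => if t = 0 then v else c (t - 1)) (N + 1) := by
  intro i j hij hj
  dsimp only
  rw [if_neg (by omega : j ≠ 0)]
  split_ifs with hi
  · have := hv (j - 1) (by omega)
    rw [this.2]
    exact ⟨this.1, by omega⟩
  · have := h (i - 1) (j - 1) (by omega) (by omega)
    rw [this.2]
    exact ⟨this.1, by omega⟩

/-- Closing an induced path with a vertex seeing exactly its ends. -/
lemma IndPath.even_of_close (hG : IsBerge G) {c : ℕ → V} {N : ℕ} (h : IndPath G c N)
    (hN : 3 ≤ N) {v : V} (h0 : G.Adj v (c 0)) (hl : G.Adj v (c N))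
    (hinner : ∀ i, 0 < i → i < N → ¬ G.Adj v (c i)) : Even N := by
  have hadj : ∀ i ≤ N, (G.Adj v (c i) ↔ i = 0 ∨ i = N) := by
    intro i hi
    constructor
    · intro h'
      by_contra hc
      exact hinner i (by omega) (by omega) h'
    · rintro (rfl | rfl) <;> assumption
  have hne : ∀ i ≤ N, v ≠ c i := by
    rintro i hi rfl
    rcases Nat.eq_zero_or_pos i with rfl | hi0
    · exact G.loopless.irrefl _ h0
    have h1 := ((h 0 i hi0 hi).2.1 h0.symm)
    rcases Nat.lt_or_ge i N with hlt | hge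
    · have h2 := ((h i N hlt le_rfl).2.1 hl)
      omega
    · omega
  have hc : IndCycle G (fun t => if t ≤ N then c t else if t = N + 1 then v else c 0) (N + 2) := by
    refine ⟨by simp, fun i j hij hj => ?_⟩
    dsimp only
    rw [if_pos (by omega : i ≤ N)]
    split_ifs with h1 h2
    · have := h i j hij h1
      rw [this.2]
      exact ⟨this.1, by omega⟩
    · rw [G.adj_comm, hadj i (by omega)]
      exact ⟨(hne i (by omega)).symm, by omega⟩
    · omega
  have := hc.even hG (by omega)
  rw [Nat.even_add] at this
  simpa using this

lemma IndPath.cap {c : ℕ → V} {N : ℕ} (h : IndPath G c N) (hN : 1 ≤ N) {u w : V}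
    (hu : AttachedAt G c N 0 u) (hw : AttachedAt G c N N w) (huw : ¬ G.Adj u w) :
    IndPath G (fun t => if t ≤ N + 1 then if t = 0 then u else c (t - 1) else w) (N + 2) := by
  refine (h.cons hu).snoc fun t ht => ?_
  dsimp only
  split_ifs with h0
  · refine ⟨?_, by rw [G.adj_comm]; simp only [huw, false_iff]; omega⟩
    rintro rfl
    have := (hw 0 (by omega)).2.symm.trans (hu 0 (by omega)).2
    omega
  · have := hw (t - 1) (by omega)
    rw [this.2]
    exact ⟨this.1, by omega⟩

/-- Parity of an induced path whose two one-vertex extensions are joined by a further vertex. -/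
lemma IndPath.even_of_cap_close (hG : IsBerge G) {c : ℕ → V} {N : ℕ} (h : IndPath G c N)
    (hN : 1 ≤ N) {u w z : V} (hu : AttachedAt G c N 0 u) (hw : AttachedAt G c N N w)
    (huw : ¬ G.Adj u w) (hzu : G.Adj z u) (hzw : G.Adj z w)
    (hz : ∀ t ≤ N, ¬ G.Adj z (c t)) : Even N := by
  have := (h.cap hN hu hw huw).even_of_close hG (by omega) (v := z) (by simpa using hzu)
    (by simpa using hzw) (fun i hi hi' => by
      rw [if_pos (by omega), if_neg (by omega)]
      exact hz _ (by omega))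
  rw [Nat.even_add] at this
  simpa using this

lemma IndPath.odd_of_cap_adj (hG : IsBerge G) {c : ℕ → V} {N : ℕ} (h : IndPath G c N)
    (hN : 2 ≤ N) {u w : V} (hu : AttachedAt G c N 0 u) (hw : AttachedAt G c N N w)
    (huw : G.Adj u w) : Odd N := by
  have := (h.snoc hw).even_of_close hG (by omega) (v := u)
    (by simpa using (hu 0 (by omega)).2.2 rfl) (by simpa using huw) (fun i hi hi' => by
      rw [if_pos (by omega), (hu i (by omega)).2]
      omega)
  rw [Nat.even_add_one] at this
  exact Nat.not_even_iff_odd.1 this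

lemma IndPath.odd_of_cap_close_two (hG : IsBerge G) {c : ℕ → V} {N : ℕ} (h : IndPath G c N)
    (hN : 1 ≤ N) {u w u' w' : V} (hu : AttachedAt G c N 0 u) (hw : AttachedAt G c N N w)
    (huw : ¬ G.Adj u w) (hwu' : G.Adj w u') (huu' : ¬ G.Adj u u') (hne : u' ≠ u)
    (huw' : G.Adj u w') (hww' : ¬ G.Adj w w') (hu'w' : G.Adj u' w')
    (hu' : ∀ t ≤ N, u' ≠ c t ∧ ¬ G.Adj u' (c t))
    (hw' : ∀ t ≤ N, ¬ G.Adj w' (c t)) : Odd N := by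
  have h1 := (h.cap hN hu hw huw).snoc (v := u') (fun t ht => by
    dsimp only
    split_ifs with h1 h2
    · rw [G.adj_comm]
      simp only [huu', false_iff]
      exact ⟨hne, by omega⟩
    · have := hu' (t - 1) (by omega)
      simp only [this.2, false_iff]
      exact ⟨this.1, by omega⟩
    · rw [G.adj_comm]
      simp only [hwu', true_iff]
      exact ⟨hwu'.ne', by omega⟩)
  have := h1.even_of_close hG (by omega) (v := w') (by simpa using huw'.symm)
    (by simpa using hu'w'.symm) (fun i hi hi' => by
      rw [if_pos (by omega)]
      split_ifs with h1 h2
      · omega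
      · exact hw' _ (by omega)
      · rwa [G.adj_comm])
  rw [Nat.even_add] at this
  have h3 : ¬ Even (2 + 1) := by decide
  rw [Nat.add_assoc, Nat.even_add] at *
  grind

/-- The number, as an element of `ℕ`, of `t < L` such that `M` holds at `t` and `t + 1`. -/
noncomputable def edgeCount (M : ℕ → Prop) (L : ℕ) : ℕ :=
  open Classical in ∑ t ∈ Finset.range L, if M t ∧ M (t + 1) then 1 else 0

lemma exists_of_odd_edgeCount {M : ℕ → Prop} {L : ℕ} (h : Odd (edgeCount M L)) :
    ∃ t < L, M t ∧ M (t + 1) := by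
  by_contra! hc
  have : edgeCount M L = 0 := Finset.sum_eq_zero fun t ht => by
    rw [if_neg]
    exact fun h => hc t (Finset.mem_range.1 ht) h.1 h.2
  rw [this] at h
  exact absurd h (by decide)

lemma edgeCount_succ (M : ℕ → Prop) (L : ℕ) [Decidable (M L ∧ M (L + 1))] :
    edgeCount M (L + 1) = edgeCount M L + if M L ∧ M (L + 1) then 1 else 0 := by
  rw [edgeCount, Finset.sum_range_succ, ← edgeCount]
  congr

lemma edgeCount_mod_two {M : ℕ → Prop} {L : ℕ} (h0 : M 0)
    (hgap : ∀ i j, i < j → j ≤ L → M i → M j → (∀ t, i < t → t < j → ¬ M t) →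
      Odd (j - i) → j = i + 1) :
    ∀ j ≤ L, M j → edgeCount M j % 2 = j % 2 := by
  classical
  intro j
  induction j using Nat.strong_induction_on with
  | _ j ih =>
    intro hj hM
    rcases Nat.eq_zero_or_pos j with rfl | hpos
    · simp [edgeCount]
    set i := Nat.findGreatest M (j - 1) with hi
    have hMi : M i := Nat.findGreatest_spec (Nat.zero_le _) h0
    have hij : i ≤ j - 1 := Nat.findGreatest_le _
    have hbetween : ∀ t, i < t → t < j → ¬ M t := fun t h1 h2 =>
      Nat.findGreatest_is_greatest h1 (by omega)
    have hrec := ih i (by omega) (by omega) hMi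
    by_cases hone : j = i + 1
    · rw [hone] at hM ⊢
      rw [edgeCount_succ, if_pos ⟨hMi, hM⟩]
      omega
    have hconst : ∀ d, i + d ≤ j → edgeCount M (i + d) = edgeCount M i := by
      intro d
      induction d with
      | zero => simp
      | succ d ihd =>
        intro hd
        rw [← Nat.add_assoc, edgeCount_succ, ihd (by omega), if_neg, add_zero]
        rintro ⟨h1, h2⟩
        rcases Nat.eq_zero_or_pos d with rfl | hd0
        · exact hbetween _ (by omega) (by omega) h2
        · exact hbetween _ (by omega) (by omega) h1
    have hc := hconst (j - i) (by omega)
    rw [Nat.add_sub_cancel' (by omega)] at hc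
    have hpar : ¬ Odd (j - i) := fun ho =>
      hone (hgap i j (by omega) hj hMi hM hbetween ho)
    rw [Nat.odd_iff] at hpar
    omega

lemma attachedAt_first {y : ℕ → V} {K : ℕ} {v : V}
    (h : SeqComplete G (fun t => y (t + 1)) (K - 1) v) (hnot : ¬ SeqComplete G y K v)
    (hne : ∀ t ≤ K, v ≠ y t) : AttachedAt Gᶜ y K 0 v := by
  have hpos : ∀ t ≤ K, t ≠ 0 → G.Adj v (y t) := fun t ht h0 => by
    simpa [Nat.sub_add_cancel (Nat.pos_of_ne_zero h0)] using h (t - 1) (by omega)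
  refine fun t ht => ⟨hne t ht, ?_⟩
  rw [compl_adj]
  refine ⟨fun h' => by_contra fun h0 => h'.2 (hpos t ht h0), ?_⟩
  rintro rfl
  refine ⟨hne 0 ht, fun hadj => hnot fun s hs => ?_⟩
  rcases Nat.eq_zero_or_pos s with rfl | hs0
  · exact hadj
  · exact hpos s hs (by omega)

lemma attachedAt_last {y : ℕ → V} {K : ℕ} {v : V}
    (h : SeqComplete G y (K - 1) v) (hnot : ¬ SeqComplete G y K v)
    (hne : ∀ t ≤ K, v ≠ y t) : AttachedAt Gᶜ y K K v := by
  refine fun t ht => ⟨hne t ht, ?_⟩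
  rw [compl_adj]
  refine ⟨fun h' => by_contra fun h0 => h'.2 (h t (by omega)), ?_⟩
  rintro rfl
  refine ⟨hne t ht, fun hadj => hnot fun s hs => ?_⟩
  rcases Nat.lt_or_ge s t with hlt | hge
  · exact h s (by omega)
  · rwa [le_antisymm hs hge]

lemma AttachedAt.seqComplete_tail {y : ℕ → V} {K : ℕ} {v : V} (hK : 1 ≤ K)
    (h : AttachedAt Gᶜ y K 0 v) : SeqComplete G (fun t => y (t + 1)) (K - 1) v := by
  intro t ht
  by_contra hc
  have := h (t + 1) (by omega)
  exact absurd (this.2.1 ⟨this.1, hc⟩) (by omega)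

lemma AttachedAt.seqComplete_init {y : ℕ → V} {K : ℕ} {v : V} (hK : 1 ≤ K)
    (h : AttachedAt Gᶜ y K K v) : SeqComplete G y (K - 1) v := by
  intro t ht
  by_contra hc
  have := h t (by omega)
  exact absurd (this.2.1 ⟨this.1, hc⟩) (by omega)

/-- For an antipath with an odd number of vertices and a path (or a hole minus an edge) whose
ends, but no interior vertices, are complete to it, if both truncations of the antipath have
complete edges on the path, then the path has length three. -/
lemma eq_three_of_truncated_edges (hG : IsBerge G) {y : ℕ → V} {K : ℕ} (hy : IndPath Gᶜ y K)
    (hKe : Even K) (hK : 2 ≤ K) {p : ℕ → V} {N : ℕ} (hN : 3 ≤ N)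
    (hp : ∀ i j, i < j → j ≤ N → ¬ (i = 0 ∧ j = N) →
      p i ≠ p j ∧ (G.Adj (p i) (p j) ↔ j = i + 1))
    (hdisj : ∀ i ≤ N, ∀ t ≤ K, p i ≠ y t)
    (hinner : ∀ i, 0 < i → i < N → ¬ SeqComplete G y K (p i))
    (hU : ∃ i < N, SeqComplete G (fun t => y (t + 1)) (K - 1) (p i) ∧
      SeqComplete G (fun t => y (t + 1)) (K - 1) (p (i + 1)))
    (hW : ∃ i < N, SeqComplete G y (K - 1) (p i) ∧ SeqComplete G y (K - 1) (p (i + 1))) :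
    N = 3 ∧ ((AttachedAt Gᶜ y K 0 (p 1) ∧ AttachedAt Gᶜ y K K (p 2)) ∨
      (AttachedAt Gᶜ y K 0 (p 2) ∧ AttachedAt Gᶜ y K K (p 1))) := by
  have hclose : ∀ u w, 0 < u → u < N → 0 < w → w < N →
      SeqComplete G (fun t => y (t + 1)) (K - 1) (p u) → SeqComplete G y (K - 1) (p w) →
      w = u + 1 ∨ u = w + 1 := by
    intro u w hu hu' hw hw' hcu hcw
    have hau := attachedAt_first hcu (hinner u hu hu') (hdisj u hu'.le)
    have haw := attachedAt_last hcw (hinner w hw hw') (hdisj w hw'.le)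
    by_contra hc
    have hne : u ≠ w := by
      rintro rfl
      have := (hau 0 (by omega)).2.symm.trans (haw 0 (by omega)).2
      omega
    have hadj : Gᶜ.Adj (p u) (p w) := by
      rcases lt_or_gt_of_ne hne with hlt | hlt
      · have := hp u w hlt hw'.le (by omega)
        exact ⟨this.1, fun h => by have := this.2.1 h; omega⟩
      · have := hp w u hlt hu'.le (by omega)
        exact ⟨this.1.symm, fun h => by have := this.2.1 h.symm; omega⟩
    have := hy.odd_of_cap_adj hG.compl hK hau haw hadj
    exact (Nat.not_even_iff_odd.2 this) hKe
  have hpick : ∀ P : V → Prop, (∃ i < N, P (p i) ∧ P (p (i + 1))) →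
      ∃ i j, 0 < i ∧ i < N ∧ j ≤ N ∧ (j = i + 1 ∨ i = j + 1) ∧ P (p i) ∧ P (p j) := by
    rintro P ⟨i, hi, h1, h2⟩
    rcases Nat.eq_zero_or_pos i with rfl | hpos
    · exact ⟨1, 0, by omega, by omega, by omega, by omega, h2, h1⟩
    · exact ⟨i, i + 1, hpos, hi, hi, by omega, h1, h2⟩
  obtain ⟨u, u', hu0, huN, hu'N, huu', hcu, hcu'⟩ := hpick _ hU
  obtain ⟨w, w', hw0, hwN, hw'N, hww', hcw, hcw'⟩ := hpick _ hW
  have huw := hclose u w hu0 huN hw0 hwN hcu hcw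
  have hu'end : u' = 0 ∨ u' = N := by
    by_contra hc
    have := hclose u' w (by omega) (by omega) hw0 hwN hcu' hcw
    omega
  have hw'end : w' = 0 ∨ w' = N := by
    by_contra hc
    have := hclose u w' hu0 huN (by omega) (by omega) hcu hcw'
    omega
  refine ⟨by omega, ?_⟩
  have hau := attachedAt_first hcu (hinner u hu0 huN) (hdisj u huN.le)
  have haw := attachedAt_last hcw (hinner w hw0 hwN) (hdisj w hwN.le)
  have hcases : (u = 1 ∧ w = 2) ∨ (u = 2 ∧ w = 1) := by omega
  rcases hcases with ⟨rfl, rfl⟩ | ⟨rfl, rfl⟩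
  · exact Or.inl ⟨hau, haw⟩
  · exact Or.inr ⟨hau, haw⟩

lemma edgeCount_or {A B : ℕ → Prop} {N : ℕ}
    (h : ∀ i < N, (A i → B (i + 1) → (A i ∧ A (i + 1)) ∨ (B i ∧ B (i + 1))) ∧
      (B i → A (i + 1) → (A i ∧ A (i + 1)) ∨ (B i ∧ B (i + 1))) ∧
      ¬ ((A i ∧ A (i + 1)) ∧ (B i ∧ B (i + 1)))) :
    edgeCount (fun i => A i ∨ B i) N = edgeCount A N + edgeCount B N := by
  rw [edgeCount, edgeCount, edgeCount, ← Finset.sum_add_distrib]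
  refine Finset.sum_congr rfl fun i hi => ?_
  obtain ⟨h1, h2, h3⟩ := h i (Finset.mem_range.1 hi)
  by_cases hA : A i ∧ A (i + 1)
  · rw [if_pos hA, if_neg (fun hB => h3 ⟨hA, hB⟩), if_pos ⟨Or.inl hA.1, Or.inl hA.2⟩]
  by_cases hB : B i ∧ B (i + 1)
  · rw [if_neg hA, if_pos hB, if_pos ⟨Or.inr hB.1, Or.inr hB.2⟩]
  rw [if_neg hA, if_neg hB, if_neg]
  rintro ⟨ha | hb, ha' | hb'⟩
  · exact hA ⟨ha, ha'⟩
  · exact (h1 ha hb').elim hA hB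
  · exact (h2 hb ha').elim hA hB
  · exact hB ⟨hb, hb'⟩

lemma IndPath.even_gap (hG : IsBerge G) {p : ℕ → V} {N i j : ℕ} (hp : IndPath G p N)
    (hij : i < j) (hj : j ≤ N) {u w z : V} (huw : ¬ G.Adj u w)
    (hpu : ∀ t ≤ N, p t ≠ u) (hpw : ∀ t ≤ N, p t ≠ w) (hiu : G.Adj (p i) u)
    (hju : ¬ G.Adj (p j) u) (hjw : G.Adj (p j) w) (hiw : ¬ G.Adj (p i) w)
    (hno : ∀ t, i < t → t < j → ¬ G.Adj (p t) u ∧ ¬ G.Adj (p t) w)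
    (hzu : G.Adj z u) (hzw : G.Adj z w) (hz : ∀ t, i ≤ t → t ≤ j → ¬ G.Adj z (p t)) :
    Even (j - i) := by
  refine (hp.shift i (j - i) (by omega)).even_of_cap_close hG (by omega) (u := u) (w := w) (z := z)
    (fun t ht => ⟨(hpu _ (by omega)).symm, ?_⟩) (fun t ht => ⟨(hpw _ (by omega)).symm, ?_⟩)
    huw hzu hzw (fun t ht => hz _ (by omega) (by omega))
  · dsimp only
    rw [G.adj_comm]
    rcases Nat.eq_zero_or_pos t with rfl | ht0
    · simpa using hiu
    rcases Nat.lt_or_ge t (j - i) with h1 | h1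
    · have := (hno (t + i) (by omega) (by omega)).1
      simp only [this, false_iff]
      omega
    · rw [show t + i = j by omega]
      simp only [hju, false_iff]
      omega
  · dsimp only
    rw [G.adj_comm]
    rcases Nat.eq_zero_or_pos t with rfl | ht0
    · rw [Nat.zero_add]
      simp only [hiw, false_iff]
      omega
    rcases Nat.lt_or_ge t (j - i) with h1 | h1
    · have := (hno (t + i) (by omega) (by omega)).2
      simp only [this, false_iff]
      omega
    · rw [show t + i = j by omega]
      simp only [hjw, true_iff]
      omega

/-- A form of the Roussel–Rubio lemma: if the ends of an odd path are complete to an antipath, and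
so is some further vertex with no neighbours in the interior of the path, then some interior
vertex of the path is complete to the antipath. -/
lemma exists_interior_seqComplete (hG : IsBerge G) {K : ℕ} {y : ℕ → V} (hy : IndPath Gᶜ y K)
    {p : ℕ → V} {N : ℕ} (hp : IndPath G p N) (hN : 3 ≤ N) (hNo : Odd N)
    (hdisj : ∀ i ≤ N, ∀ t ≤ K, p i ≠ y t) (h0 : SeqComplete G y K (p 0))
    (hl : SeqComplete G y K (p N)) {z : V} (hz : SeqComplete G y K z)
    (hzp : ∀ i, 0 < i → i < N → ¬ G.Adj z (p i)) :
    ∃ i, 0 < i ∧ i < N ∧ SeqComplete G y K (p i) := by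
  induction K using Nat.strong_induction_on generalizing y p N with
  | _ K ih =>
  by_contra! hinner
  have hzne : ∀ i, 0 < i → i < N → z ≠ p i := fun i hi hi' h => hinner i hi hi' (h ▸ hz)
  -- the induction hypothesis, applied to a shorter antipath and a gap of the path
  have hrec : ∀ (K' : ℕ) (s : ℕ), K' < K → K' + s ≤ K → ∀ i j, i < j → j ≤ N →
      SeqComplete G (fun t => y (t + s)) K' (p i) → SeqComplete G (fun t => y (t + s)) K' (p j) →
      Odd (j - i) → j ≠ i + 1 →
      ∃ t, i < t ∧ t < j ∧ SeqComplete G (fun t => y (t + s)) K' (p t) := by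
    intro K' s hK' hs i j hij hj hi1 hj1 hodd hne
    have h3 : 3 ≤ j - i := by rw [Nat.odd_iff] at hodd; omega
    obtain ⟨t, ht0, ht1, ht2⟩ := ih K' hK' (y := fun t => y (t + s)) (hy.shift s K' hs)
      (p := fun t => p (t + i)) (N := j - i) (hp.shift i (j - i) (by omega)) h3 hodd
      (fun a ha t ht => hdisj _ (by omega) _ (by omega)) (by simpa using hi1)
      (by simpa [Nat.sub_add_cancel hij.le] using hj1) (fun t ht => hz _ (by omega))
      (fun t ht ht' => hzp _ (by omega) (by omega))
    exact ⟨t + i, by omega, by omega, ht2⟩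
  rcases Nat.eq_zero_or_pos K with rfl | hKpos
  · have := hp.even_of_close hG hN (h0 0 le_rfl).symm (hl 0 le_rfl).symm (fun i hi hi' hadj =>
      hinner i hi hi' fun t ht => by rw [Nat.le_zero.1 ht]; exact hadj.symm)
    exact Nat.not_even_iff_odd.2 hNo this
  set A : ℕ → Prop := fun i => SeqComplete G (fun t => y (t + 1)) (K - 1) (p i) with hA
  set B : ℕ → Prop := fun i => SeqComplete G y (K - 1) (p i) with hB
  have hA0 : A 0 := fun t ht => h0 _ (by omega)
  have hAN : A N := fun t ht => hl _ (by omega)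
  have hB0 : B 0 := fun t ht => h0 _ (by omega)
  have hBN : B N := fun t ht => hl _ (by omega)
  have hAgap : ∀ i j, i < j → j ≤ N → A i → A j → (∀ t, i < t → t < j → ¬ A t) →
      Odd (j - i) → j = i + 1 := by
    intro i j hij hj hi1 hj1 hno hodd
    by_contra hne
    obtain ⟨t, ht0, ht1, ht2⟩ := hrec (K - 1) 1 (by omega) (by omega) i j hij hj hi1 hj1 hodd hne
    exact hno t ht0 ht1 ht2
  have hBgap : ∀ i j, i < j → j ≤ N → B i → B j → (∀ t, i < t → t < j → ¬ B t) →
      Odd (j - i) → j = i + 1 := by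
    intro i j hij hj hi1 hj1 hno hodd
    by_contra hne
    obtain ⟨t, ht0, ht1, ht2⟩ := hrec (K - 1) 0 (by omega) (by omega) i j hij hj hi1 hj1 hodd hne
    exact hno t ht0 ht1 ht2
  have hEA := edgeCount_mod_two hA0 hAgap N le_rfl hAN
  have hEB := edgeCount_mod_two hB0 hBgap N le_rfl hBN
  rw [Nat.odd_iff] at hNo
  have hatA : ∀ i, 0 < i → i < N → A i → AttachedAt Gᶜ y K 0 (p i) := fun i hi hi' hAi =>
    attachedAt_first hAi (hinner i hi hi') (hdisj i hi'.le)
  have hatB : ∀ i, 0 < i → i < N → B i → AttachedAt Gᶜ y K K (p i) := fun i hi hi' hBi =>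
    attachedAt_last hBi (hinner i hi hi') (hdisj i hi'.le)
  have hAB : ∀ i, 0 < i → i < N → A i → B i → False := fun i hi hi' hAi hBi => by
    have := (hatA i hi hi' hAi 0 (by omega)).2.symm.trans (hatB i hi hi' hBi 0 (by omega)).2
    omega
  have hAend : ∀ i ≤ N, A i → B i → i = 0 ∨ i = N := fun i hi hAi hBi => by
    by_contra hc
    exact hAB i (by omega) (by omega) hAi hBi
  rcases Nat.even_or_odd K with hKe | hKo
  · obtain ⟨rfl, hcase⟩ := eq_three_of_truncated_edges hG hy hKe
      (by rw [Nat.even_iff] at hKe; omega) hN (fun i j hij hj _ => hp i j hij hj) hdisj hinner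
      (exists_of_odd_edgeCount (M := A) (Nat.odd_iff.2 (by omega)))
      (exists_of_odd_edgeCount (M := B) (Nat.odd_iff.2 (by omega)))
    have p01 := hp 0 1 (by omega) (by omega)
    have p02 := hp 0 2 (by omega) (by omega)
    have p03 := hp 0 3 (by omega) (by omega)
    have p12 := hp 1 2 (by omega) (by omega)
    have p13 := hp 1 3 (by omega) (by omega)
    have p23 := hp 2 3 (by omega) (by omega)
    norm_num at p01 p02 p03 p12 p13 p23
    have hcompl : ∀ v, SeqComplete G y K v → ∀ t ≤ K, ¬ Gᶜ.Adj v (y t) :=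
      fun v hv t ht h => h.2 (hv t ht)
    rcases hcase with ⟨h1, h2⟩ | ⟨h2, h1⟩
    · have := hy.odd_of_cap_close_two hG.compl hKpos h1 h2 (u' := p 0) (w' := p 3)
        (fun h => h.2 p12.2) ⟨Ne.symm p02.1, fun h => p02.2 h.symm⟩ (fun h => h.2 p01.2.symm)
        p01.1 ⟨p13.1, p13.2⟩ (fun h => h.2 p23.2) ⟨p03.1, p03.2⟩
        (fun t ht => ⟨hdisj 0 (by omega) t ht, hcompl _ h0 t ht⟩) (hcompl _ hl)
      exact Nat.not_even_iff_odd.2 this hKe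
    · have := hy.odd_of_cap_close_two hG.compl hKpos h2 h1 (u' := p 3) (w' := p 0)
        (fun h => h.2 p12.2.symm) ⟨p13.1, p13.2⟩ (fun h => h.2 p23.2)
        (Ne.symm p23.1) ⟨Ne.symm p02.1, fun h => p02.2 h.symm⟩ (fun h => h.2 p01.2.symm)
        ⟨Ne.symm p03.1, fun h => p03.2 h.symm⟩
        (fun t ht => ⟨hdisj 3 (by omega) t ht, hcompl _ hl t ht⟩) (hcompl _ h0)
      exact Nat.not_even_iff_odd.2 this hKe
  · -- the two kinds of marked vertices are never adjacent
    have hnadj : ∀ u w, 0 < u → u < N → 0 < w → w < N → A u → B w → ¬ G.Adj (p u) (p w) := by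
      intro u w hu hu' hw hw' hAu hBw hadj
      have := hy.even_of_cap_close hG.compl hKpos (hatA u hu hu' hAu) (hatB w hw hw' hBw) (z := z)
        (fun h => h.2 hadj) ⟨hzne u hu hu', hzp u hu hu'⟩ ⟨hzne w hw hw', hzp w hw hw'⟩
        (fun t ht h => h.2 (hz t ht))
      exact Nat.not_even_iff_odd.2 hKo this
    have hmixed : ∀ i j, i < j → j ≤ N → ((A i ∧ B j) ∨ (B i ∧ A j)) → 0 < i → j < N →
        (∀ t, i < t → t < j → ¬ A t ∧ ¬ B t) → Odd (j - i) → j = i + 1 := by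
      intro i j hij hj hm hi0 hjN hno hodd
      by_contra hne
      rcases Nat.lt_or_ge K 2 with hK1 | hK2
      · obtain rfl : K = 1 := by omega
        have hy01 := hy 0 1 (by omega) le_rfl
        norm_num at hy01
        have hA1 : ∀ t, A t ↔ G.Adj (p t) (y 1) := fun t =>
          ⟨fun h => h 0 (by omega), fun h s hs => by
            rw [show s = 0 by omega]; exact h⟩
        have hB1 : ∀ t, B t ↔ G.Adj (p t) (y 0) := fun t =>
          ⟨fun h => h 0 (by omega), fun h s hs => by
            rw [show s = 0 by omega]; exact h⟩
        rcases hm with ⟨hAi, hBj⟩ | ⟨hBi, hAj⟩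
        · have hBi : ¬ B i := fun h => hAB i hi0 (by omega) hAi h
          have hAj : ¬ A j := fun h => hAB j (by omega) hjN h hBj
          simp only [hA1, hB1] at hAi hBi hAj hBj hno
          exact Nat.not_even_iff_odd.2 hodd (hp.even_gap hG hij hj (fun h => hy01.2 h.symm)
            (fun t ht => hdisj t ht 1 le_rfl) (fun t ht => hdisj t ht 0 (by omega)) hAi hAj hBj hBi
            hno (hz 1 le_rfl) (hz 0 (by omega)) (fun t h1 h2 => hzp t (by omega) (by omega)))
        · have hAi : ¬ A i := fun h => hAB i hi0 (by omega) h hBi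
          have hBj : ¬ B j := fun h => hAB j (by omega) hjN hAj h
          simp only [hA1, hB1] at hAi hBi hAj hBj hno
          exact Nat.not_even_iff_odd.2 hodd (hp.even_gap hG hij hj hy01.2
            (fun t ht => hdisj t ht 0 (by omega)) (fun t ht => hdisj t ht 1 le_rfl) hBi hBj hAj hAi
            (fun t h1 h2 => (hno t h1 h2).symm) (hz 0 (by omega)) (hz 1 le_rfl)
            (fun t h1 h2 => hzp t (by omega) (by omega)))
      · have hmid : ∀ t, A t ∨ B t → SeqComplete G (fun t => y (t + 1)) (K - 2) (p t) := by
          rintro t (h | h) s hs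
          · exact h s (by omega)
          · exact h (s + 1) (by omega)
        obtain ⟨t, ht0, ht1, ht2⟩ := hrec (K - 2) 1 (by omega) (by omega) i j hij hj
          (hmid i (by tauto)) (hmid j (by tauto)) hodd hne
        have htne := hdisj t (by omega)
        have hmidadj : ∀ s, 0 < s → s < K → G.Adj (p t) (y s) := fun s hs hs' => by
          simpa [Nat.sub_add_cancel hs] using ht2 (s - 1) (by omega)
        have hlast : ¬ G.Adj (p t) (y K) := fun h => (hno t ht0 ht1).1 fun s hs => by
          rcases Nat.lt_or_ge (s + 1) K with h1 | h1
          · exact hmidadj _ (by omega) h1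
          · rwa [show K = s + 1 by omega] at h
        have hfirst : ¬ G.Adj (p t) (y 0) := fun h => (hno t ht0 ht1).2 fun s hs => by
          rcases Nat.eq_zero_or_pos s with rfl | h1
          · exact h
          · exact hmidadj s h1 (by omega)
        have := hy.even_of_close hG.compl (by rw [Nat.odd_iff] at hKo; omega) (v := p t)
          ⟨htne 0 (by omega), hfirst⟩ ⟨htne K le_rfl, hlast⟩
          (fun s hs hs' h => h.2 (hmidadj s hs hs'))
        exact Nat.not_even_iff_odd.2 hKo this
    have hM := edgeCount_mod_two (M := fun i => A i ∨ B i) (Or.inl hA0) (L := N) (by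
      intro i j hij hj hi1 hj1 hno hodd
      have hnoA : ∀ t, i < t → t < j → ¬ A t := fun t h1 h2 h => hno t h1 h2 (Or.inl h)
      have hnoB : ∀ t, i < t → t < j → ¬ B t := fun t h1 h2 h => hno t h1 h2 (Or.inr h)
      by_cases hAA : A i ∧ A j
      · exact hAgap i j hij hj hAA.1 hAA.2 hnoA hodd
      by_cases hBB : B i ∧ B j
      · exact hBgap i j hij hj hBB.1 hBB.2 hnoB hodd
      have hi0 : 0 < i := by
        rcases Nat.eq_zero_or_pos i with rfl | h
        · tauto
        · exact h
      have hjN : j < N := by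
        rcases Nat.lt_or_ge j N with h | h
        · exact h
        · obtain rfl : j = N := by omega
          tauto
      exact hmixed i j hij hj (by tauto) hi0 hjN (fun t h1 h2 => ⟨hnoA t h1 h2, hnoB t h1 h2⟩)
        hodd) N le_rfl (Or.inl hAN)
    have hsum : edgeCount (fun i => A i ∨ B i) N = edgeCount A N + edgeCount B N := by
      refine edgeCount_or fun i hiN => ?_
      have hcon := hp i (i + 1) (by omega) hiN
      have hadj : G.Adj (p i) (p (i + 1)) := hcon.2.2 rfl
      have h1 : A i → B (i + 1) → (A i ∧ A (i + 1)) ∨ (B i ∧ B (i + 1)) := fun ha hb => by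
        rcases Nat.eq_zero_or_pos i with rfl | hi0
        · exact Or.inr ⟨hB0, hb⟩
        rcases Nat.lt_or_ge (i + 1) N with h | h
        · exact absurd hadj (hnadj _ _ hi0 (by omega) (by omega) h ha hb)
        · rw [show i + 1 = N by omega]; exact Or.inl ⟨ha, hAN⟩
      have h2 : B i → A (i + 1) → (A i ∧ A (i + 1)) ∨ (B i ∧ B (i + 1)) := fun hb ha => by
        rcases Nat.eq_zero_or_pos i with rfl | hi0
        · exact Or.inl ⟨hA0, ha⟩
        rcases Nat.lt_or_ge (i + 1) N with h | h
        · exact absurd hadj.symm (hnadj _ _ (by omega) h hi0 (by omega) ha hb)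
        · rw [show i + 1 = N by omega]; exact Or.inr ⟨hb, hBN⟩
      have h3 : ¬ ((A i ∧ A (i + 1)) ∧ (B i ∧ B (i + 1))) := by
        rintro ⟨⟨ha, ha'⟩, hb, hb'⟩
        have := hAend i hiN.le ha hb
        have := hAend (i + 1) hiN ha' hb'
        omega
      exact ⟨h1, h2, h3⟩
    omega

lemma IndCycle.shift {c : ℕ → V} {L : ℕ} (h : IndCycle G c L) (i M : ℕ) (hM : M + i ≤ L)
    (hM' : M + 2 ≤ L) : IndPath G (fun t => c (t + i)) M := by
  intro a b hab hb
  dsimp only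
  rcases Nat.lt_or_ge (b + i) L with hlt | hge
  · have := h.2 (a + i) (b + i) (by omega) hlt
    rw [this.2]
    exact ⟨this.1, by omega⟩
  · have := h.2 0 (a + i) (by omega) (by omega)
    rw [show b + i = L by omega, h.1, G.adj_comm, this.2]
    exact ⟨this.1.symm, by omega⟩

/-- A hole with at least three vertices complete to an antipath has an even number of edges
complete to it. -/
lemma IndCycle.even_edgeCount (hG : IsBerge G) {c : ℕ → V} {L : ℕ} (hc : IndCycle G c L)
    (hL : Even L) {y : ℕ → V} {K : ℕ} (hy : IndPath Gᶜ y K)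
    (hdisj : ∀ i < L, ∀ t ≤ K, c i ≠ y t) (h0 : SeqComplete G y K (c 0)) {m₁ m₂ : ℕ}
    (hm₁ : 0 < m₁) (hm : m₁ < m₂) (hm₂ : m₂ < L) (h1 : SeqComplete G y K (c m₁))
    (h2 : SeqComplete G y K (c m₂)) :
    Even (edgeCount (fun t => SeqComplete G y K (c t)) L) := by
  have hnadj : ∀ a b, a + 1 < b → b < L → ¬ (a = 0 ∧ b + 1 = L) → ¬ G.Adj (c a) (c b) :=
    fun a b hab hb hne h => by
      have := ((hc.2 a b (by omega) hb).2.1 h)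
      omega
  have hL' : SeqComplete G y K (c L) := by rwa [hc.1]
  have hdisj' : ∀ i ≤ L, ∀ t ≤ K, c i ≠ y t := fun i hi => by
    rcases Nat.lt_or_ge i L with h | h
    · exact hdisj i h
    · rw [show i = L by omega, hc.1]
      exact hdisj 0 (by omega)
  have := edgeCount_mod_two (M := fun t => SeqComplete G y K (c t)) h0 (L := L) (by
    intro i j hij hj hi1 hj1 hno hodd
    by_contra hne
    have h3 : 3 ≤ j - i := by rw [Nat.odd_iff] at hodd; omega
    have hn1 : ¬ (i < m₁ ∧ m₁ < j) := fun h => hno _ h.1 h.2 h1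
    have hn2 : ¬ (i < m₂ ∧ m₂ < j) := fun h => hno _ h.1 h.2 h2
    have hz : ∃ z, SeqComplete G y K z ∧ ∀ t, i < t → t < j → ¬ G.Adj z (c t) := by
      rcases Nat.eq_zero_or_pos i with rfl | hi0
      · exact ⟨c m₂, h2, fun t ht ht' h => hnadj t m₂ (by omega) hm₂ (by omega) h.symm⟩
      rcases Nat.lt_or_ge j L with hjL | hjL
      · exact ⟨c 0, h0, fun t ht ht' h => hnadj 0 t (by omega) (by omega) (by omega) h⟩
      · exact ⟨c m₁, h1, fun t ht ht' h => hnadj m₁ t (by omega) (by omega) (by omega) h⟩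
    obtain ⟨z, hz, hzc⟩ := hz
    obtain ⟨t, ht0, ht1, ht2⟩ := exists_interior_seqComplete hG hy
      (hc.shift i (j - i) (by omega) (by omega)) h3 hodd (fun a ha t ht => hdisj' _ (by omega) t ht)
      (by simpa using hi1) (by simpa [Nat.sub_add_cancel hij.le] using hj1) hz
      (fun t ht ht' => hzc _ (by omega) (by omega))
    exact hno (t + i) (by omega) (by omega) ht2) L le_rfl hL'
  rw [Nat.even_iff] at hL ⊢
  omega

lemma IndCycle.even_edgeCount_of_two (hG : IsBerge G) {c : ℕ → V} {L : ℕ} (hc : IndCycle G c L)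
    (hL : Even L) {y : ℕ → V} {K : ℕ} (hy : IndPath Gᶜ y K)
    (hdisj : ∀ i < L, ∀ t ≤ K, c i ≠ y t) (h0 : SeqComplete G y K (c 0)) {m : ℕ}
    (hm : 2 ≤ m) (hm' : m + 2 ≤ L) (h1 : SeqComplete G y K (c m)) :
    Even (edgeCount (fun t => SeqComplete G y K (c t)) L) := by
  by_contra hodd
  obtain ⟨t, ht, ht1, ht2⟩ := exists_of_odd_edgeCount (Nat.not_even_iff_odd.1 hodd)
  have hs : ∃ s, 0 < s ∧ s < L ∧ s ≠ m ∧ SeqComplete G y K (c s) := by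
    by_cases h : 0 < t ∧ t ≠ m
    · exact ⟨t, h.1, ht, h.2, ht1⟩
    · exact ⟨t + 1, by omega, by omega, by omega, ht2⟩
  obtain ⟨s, hs0, hsL, hsm, hs⟩ := hs
  rcases lt_or_gt_of_ne hsm with h | h
  · exact hodd (hc.even_edgeCount hG hL hy hdisj h0 hs0 h (by omega) hs h1)
  · exact hodd (hc.even_edgeCount hG hL hy hdisj h0 (by omega) h hsL h1 hs)

/-- If an antipath with an odd number of vertices has just two complete vertices in a long hole,
and these are adjacent, then its two truncations do not both have further complete vertices. -/
lemma IndCycle.false_of_truncated_complete (hG : IsBerge G) {c : ℕ → V} {L : ℕ}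
    (hc : IndCycle G c L) (hL : Even L) (hL6 : 6 ≤ L) {y : ℕ → V} {K : ℕ} (hy : IndPath Gᶜ y K)
    (hKe : Even K) (hK : 2 ≤ K) (hdisj : ∀ i < L, ∀ t ≤ K, c i ≠ y t)
    (h0 : SeqComplete G y K (c 0)) (hl : SeqComplete G y K (c (L - 1)))
    (hinner : ∀ i, 0 < i → i < L - 1 → ¬ SeqComplete G y K (c i))
    {r s : ℕ} (hr0 : 0 < r) (hr : r < L - 1) (hs0 : 0 < s) (hs : s < L - 1)
    (hcr : AttachedAt Gᶜ y K 0 (c r)) (hcs : AttachedAt Gᶜ y K K (c s)) : False := by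
  have hedge : ∀ P : V → Prop, P (c 0) → P (c (L - 1)) →
      Even (edgeCount (fun t => P (c t)) L) → ∃ t < L - 1, P (c t) ∧ P (c (t + 1)) := by
    classical
    intro P hP0 hPl hev
    refine exists_of_odd_edgeCount (M := fun t => P (c t)) ?_
    have h := edgeCount_succ (fun t => P (c t)) (L - 1)
    rw [Nat.sub_add_cancel (by omega), hc.1, if_pos ⟨hPl, hP0⟩] at h
    rw [h, Nat.even_add_one, Nat.not_even_iff_odd] at hev
    exact hev
  have hU := hedge _ (fun t ht => h0 _ (by omega)) (fun t ht => hl _ (by omega))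
    (hc.even_edgeCount hG hL (y := fun t => y (t + 1)) (K := K - 1) (hy.shift 1 (K - 1) (by omega))
      (fun i hi t ht => hdisj i hi _ (by omega)) (fun t ht => h0 _ (by omega)) hr0 hr (by omega)
      (hcr.seqComplete_tail (by omega)) (fun t ht => hl _ (by omega)))
  have hW := hedge _ (fun t ht => h0 _ (by omega)) (fun t ht => hl _ (by omega))
    (hc.even_edgeCount hG hL (y := y) (K := K - 1) (hy.mono (by omega))
      (fun i hi t ht => hdisj i hi _ (by omega)) (fun t ht => h0 _ (by omega)) hs0 hs (by omega)
      (hcs.seqComplete_init (by omega)) (fun t ht => hl _ (by omega)))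
  have := eq_three_of_truncated_edges hG hy hKe hK (p := c) (N := L - 1) (by omega)
    (fun i j hij hj hne => by
      have := hc.2 i j hij (by omega)
      rw [this.2]
      exact ⟨this.1, by omega⟩)
    (fun i hi => hdisj i (by omega)) hinner hU hW
  omega

/-- A prism with paths `q i 0, …, q i (m i)`, all of length at least two. -/
structure SeqPrism (G : SimpleGraph V) (q : Fin 3 → ℕ → V) (m : Fin 3 → ℕ) : Prop where
  two_le : ∀ i, 2 ≤ m i
  indPath : ∀ i, IndPath G (q i) (m i)
  cross : ∀ i j, i ≠ j → ∀ s t, s ≤ m i → t ≤ m j →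
    q i s ≠ q j t ∧ (G.Adj (q i s) (q j t) ↔ (s = 0 ∧ t = 0) ∨ (s = m i ∧ t = m j))

lemma SeqPrism.reverse {q : Fin 3 → ℕ → V} {m : Fin 3 → ℕ} (h : SeqPrism G q m) :
    SeqPrism G (fun i t => q i (m i - t)) m where
  two_le := h.two_le
  indPath i := (h.indPath i).reverse
  cross i j hij s t hs ht := by
    have := h.cross i j hij (m i - s) (m j - t) (by omega) (by omega)
    rw [this.2]
    exact ⟨this.1, by omega⟩

/-- The closed sequence traversing two paths of a prism. -/
def prismCycle (q : Fin 3 → ℕ → V) (m : Fin 3 → ℕ) (i j : Fin 3) (t : ℕ) : V :=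
  if t ≤ m i then q i t else if t ≤ m i + m j + 1 then q j (m i + m j + 1 - t) else q i 0

lemma SeqPrism.indCycle {q : Fin 3 → ℕ → V} {m : Fin 3 → ℕ} (h : SeqPrism G q m) {i j : Fin 3}
    (hij : i ≠ j) : IndCycle G (prismCycle q m i j) (m i + m j + 2) := by
  have hi := h.two_le i
  have hj := h.two_le j
  refine ⟨?_, fun a b hab hb => ?_⟩
  · rw [prismCycle, prismCycle, if_neg (by omega), if_neg (by omega), if_pos (by omega)]
  · rw [prismCycle, prismCycle, if_pos (by omega : b ≤ m i + m j + 1),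
      if_pos (by omega : a ≤ m i + m j + 1)]
    split_ifs with h1 h2
    · have := h.indPath i a b hab h2
      rw [this.2]
      exact ⟨this.1, by omega⟩
    · have := h.cross i j hij a (m i + m j + 1 - b) h1 (by omega)
      rw [this.2]
      exact ⟨this.1, by omega⟩
    · omega
    · have := h.indPath j (m i + m j + 1 - b) (m i + m j + 1 - a) (by omega) (by omega)
      rw [G.adj_comm, this.2]
      exact ⟨this.1.symm, by omega⟩

lemma edgeCount_add (M : ℕ → Prop) (a b : ℕ) :
    edgeCount M (a + b) = edgeCount M a + edgeCount (fun t => M (a + t)) b :=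
  Finset.sum_range_add _ _ _

lemma edgeCount_congr {M M' : ℕ → Prop} {L : ℕ} (h : ∀ t ≤ L, M t ↔ M' t) :
    edgeCount M L = edgeCount M' L := by
  refine Finset.sum_congr rfl fun t ht => ?_
  have := Finset.mem_range.1 ht
  classical exact if_congr (and_congr (h t (by omega)) (h (t + 1) (by omega))) rfl rfl

lemma edgeCount_reverse (M : ℕ → Prop) (L : ℕ) :
    edgeCount (fun t => M (L - t)) L = edgeCount M L := by
  rw [edgeCount, edgeCount, ← Finset.sum_range_reflect]
  refine Finset.sum_congr rfl fun t ht => ?_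
  have := Finset.mem_range.1 ht
  rw [show L - (L - 1 - t) = t + 1 by omega, show L - (L - 1 - t + 1) = t by omega]
  classical exact if_congr and_comm rfl rfl

open Classical in
lemma edgeCount_prismCycle (q : Fin 3 → ℕ → V) (m : Fin 3 → ℕ) {i j : Fin 3} (P : V → Prop) :
    edgeCount (fun t => P (prismCycle q m i j t)) (m i + m j + 2) =
      edgeCount (fun t => P (q i t)) (m i) + edgeCount (fun t => P (q j t)) (m j) +
      (if P (q i (m i)) ∧ P (q j (m j)) then 1 else 0) +
      (if P (q j 0) ∧ P (q i 0) then 1 else 0) := by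
  have h1 : edgeCount (fun t => P (prismCycle q m i j t)) (m i) =
      edgeCount (fun t => P (q i t)) (m i) := edgeCount_congr fun t ht => by
    rw [prismCycle, if_pos ht]
  have h2 : edgeCount (fun t => P (prismCycle q m i j (m i + 1 + t))) (m j) =
      edgeCount (fun t => P (q j t)) (m j) := by
    rw [← edgeCount_reverse (fun t => P (q j t))]
    refine edgeCount_congr fun t ht => ?_
    rw [prismCycle, if_neg (by omega), if_pos (by omega),
      show m i + m j + 1 - (m i + 1 + t) = m j - t by omega]
  rw [show m i + m j + 2 = (m i + 1 + m j) + 1 by omega, edgeCount_succ, edgeCount_add,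
    edgeCount_succ, h1, h2]
  have e1 : prismCycle q m i j (m i) = q i (m i) := by rw [prismCycle, if_pos le_rfl]
  have e2 : prismCycle q m i j (m i + 1) = q j (m j) := by
    rw [prismCycle, if_neg (by omega), if_pos (by omega)]
    congr 1
    omega
  have e3 : prismCycle q m i j (m i + 1 + m j) = q j 0 := by
    rw [prismCycle, if_neg (by omega), if_pos (by omega)]
    congr 1
    omega
  have e4 : prismCycle q m i j (m i + 1 + m j + 1) = q i 0 := by
    rw [prismCycle, if_neg (by omega), if_neg (by omega)]
  simp only [e1, e2, e3, e4]
  omega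

/-- If an odd number of edges of a hole starting at a complete vertex are complete to an antipath,
then the hole has no two vertices, away from its start, attached in the complement to the two ends
of the antipath. -/
lemma IndCycle.false_of_odd_edgeCount (hG : IsBerge G) {c : ℕ → V} {L : ℕ}
    (hc : IndCycle G c L) (hL : Even L) (hL6 : 6 ≤ L) {y : ℕ → V} {K : ℕ} (hy : IndPath Gᶜ y K)
    (hKe : Even K) (hK : 2 ≤ K) (hdisj : ∀ i < L, ∀ t ≤ K, c i ≠ y t)
    (h0 : SeqComplete G y K (c 0)) (hodd : Odd (edgeCount (fun t => SeqComplete G y K (c t)) L))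
    {r s : ℕ} (hr0 : 2 ≤ r) (hr : r + 2 ≤ L) (hs0 : 2 ≤ s) (hs : s + 2 ≤ L)
    (hcr : AttachedAt Gᶜ y K 0 (c r)) (hcs : AttachedAt Gᶜ y K K (c s)) : False := by
  have hno := Nat.not_even_iff_odd.2 hodd
  have hmid : ∀ t, 2 ≤ t → t + 2 ≤ L → ¬ SeqComplete G y K (c t) := fun t ht ht' h =>
    hno (hc.even_edgeCount_of_two hG hL hy hdisj h0 ht ht' h)
  have hboth : ¬ (SeqComplete G y K (c 1) ∧ SeqComplete G y K (c (L - 1))) := fun h =>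
    hno (hc.even_edgeCount hG hL hy hdisj h0 one_pos (by omega) (by omega) h.1 h.2)
  obtain ⟨t, ht, ht1, ht2⟩ := exists_of_odd_edgeCount hodd
  by_cases hl : SeqComplete G y K (c (L - 1))
  · refine hc.false_of_truncated_complete hG hL hL6 hy hKe hK hdisj h0 hl (fun i hi hi' h => ?_)
      (by omega) (by omega) (by omega) (by omega) hcr hcs
    rcases Nat.lt_or_ge i 2 with h' | h'
    · exact hboth ⟨by rwa [show i = 1 by omega] at h, hl⟩
    · exact hmid i h' (by omega) h
  · have h1 : SeqComplete G y K (c 1) := by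
      by_contra h1
      rcases Nat.eq_zero_or_pos t with rfl | htp
      · exact h1 ht2
      rcases Nat.lt_or_ge t 2 with h | h
      · exact h1 (by rwa [show t = 1 by omega] at ht1)
      rcases Nat.lt_or_ge (t + 1) L with h' | h'
      · exact hmid t h (by omega) ht1
      · exact hl (by rwa [show t = L - 1 by omega] at ht1)
    refine hc.reverse.false_of_truncated_complete hG hL hL6 hy hKe hK (fun i hi => ?_)
      (by simpa [hc.1] using h0) (by rwa [show L - (L - 1) = 1 by omega]) (fun i hi hi' h => ?_)
      (r := L - r) (s := L - s)
      (by omega) (by omega) (by omega) (by omega) (by rwa [Nat.sub_sub_self (by omega)])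
      (by rwa [Nat.sub_sub_self (by omega)])
    · rcases Nat.eq_zero_or_pos i with rfl | hi0
      · simpa [hc.1] using hdisj 0 (by omega)
      · exact hdisj (L - i) (by omega)
    · rcases Nat.lt_or_ge i 2 with h' | h'
      · exact hl (by rwa [show i = 1 by omega] at h)
      · exact hmid (L - i) (by omega) (by omega) h

lemma prismCycle_ne {q : Fin 3 → ℕ → V} {m : Fin 3 → ℕ} {v : V}
    (h : ∀ i, ∀ t ≤ m i, q i t ≠ v) (i j : Fin 3) (t : ℕ) : prismCycle q m i j t ≠ v := by
  rw [prismCycle]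
  split_ifs
  · exact h i t (by omega)
  · exact h j _ (by omega)
  · exact h i 0 (by omega)

lemma prismCycle_zero (q : Fin 3 → ℕ → V) (m : Fin 3 → ℕ) (i j : Fin 3) :
    prismCycle q m i j 0 = q i 0 := if_pos (Nat.zero_le _)

lemma prismCycle_left (q : Fin 3 → ℕ → V) (m : Fin 3 → ℕ) (i j : Fin 3) :
    prismCycle q m i j (m i) = q i (m i) := if_pos le_rfl

lemma prismCycle_right (q : Fin 3 → ℕ → V) (m : Fin 3 → ℕ) (i j : Fin 3) :
    prismCycle q m i j (m i + 1) = q j (m j) := by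
  rw [prismCycle, if_neg (by omega), if_pos (by omega)]
  congr 1
  omega

lemma SeqPrism.even_add {q : Fin 3 → ℕ → V} {m : Fin 3 → ℕ} (hp : SeqPrism G q m)
    (hG : IsBerge G) {i j : Fin 3} (hij : i ≠ j) : Even (m i + m j + 2) :=
  (hp.indCycle hij).even hG (by have := hp.two_le i; have := hp.two_le j; omega)

lemma SeqPrism.even_edgeCount {q : Fin 3 → ℕ → V} {m : Fin 3 → ℕ} (hp : SeqPrism G q m)
    (hG : IsBerge G) {y : ℕ → V} {K : ℕ} (hy : IndPath Gᶜ y K)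
    (hdisj : ∀ i, ∀ t ≤ m i, ∀ s ≤ K, q i t ≠ y s) {i l : Fin 3} (hil : i ≠ l)
    (hl : SeqComplete G y K (q l 0))
    (hb : SeqComplete G y K (q l (m l)) ∨ SeqComplete G y K (q i (m i))) :
    Even (edgeCount (fun t => SeqComplete G y K (prismCycle q m l i t)) (m l + m i + 2)) := by
  have h1 := hp.two_le i
  have h2 := hp.two_le l
  have hd : ∀ a < m l + m i + 2, ∀ s ≤ K, prismCycle q m l i a ≠ y s := fun a _ s hs =>
    prismCycle_ne (fun i t ht => hdisj i t ht s hs) l i a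
  have h0 : SeqComplete G y K (prismCycle q m l i 0) := by rwa [prismCycle_zero]
  rcases hb with hb | hb
  · exact (hp.indCycle hil.symm).even_edgeCount_of_two hG (hp.even_add hG hil.symm) hy hd h0
      (m := m l) (by omega) (by omega) (by rwa [prismCycle_left])
  · exact (hp.indCycle hil.symm).even_edgeCount_of_two hG (hp.even_add hG hil.symm) hy hd h0
      (m := m l + 1) (by omega) (by omega) (by rwa [prismCycle_right])

lemma SeqPrism.false_of_attached {q : Fin 3 → ℕ → V} {m : Fin 3 → ℕ} (hp : SeqPrism G q m)
    (hG : IsBerge G) {y : ℕ → V} {K : ℕ} (hy : IndPath Gᶜ y K) (hKe : Even K) (hK : 2 ≤ K)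
    (hdisj : ∀ i, ∀ t ≤ m i, ∀ s ≤ K, q i t ≠ y s) {i j l : Fin 3} (hij : i ≠ j) (hil : i ≠ l)
    (hjl : j ≠ l) (hi : AttachedAt Gᶜ y K 0 (q i 0)) (hj : AttachedAt Gᶜ y K K (q j 0))
    (hl : SeqComplete G y K (q l 0))
    (hb : ∀ p r, p ≠ r → SeqComplete G y K (q p (m p)) ∨ SeqComplete G y K (q r (m r))) :
    False := by
  classical
  have hni : ¬ SeqComplete G y K (q i 0) := fun h =>
    ((compl_adj _ _ _).1 ((hi 0 (by omega)).2.2 rfl)).2 (h 0 (by omega))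
  have hnj : ¬ SeqComplete G y K (q j 0) := fun h =>
    ((compl_adj _ _ _).1 ((hj K le_rfl).2.2 rfl)).2 (h K le_rfl)
  have hli := hp.even_edgeCount hG hy hdisj hil hl (hb _ _ hil.symm)
  have hlj := hp.even_edgeCount hG hy hdisj hjl hl (hb _ _ hjl.symm)
  simp only [edgeCount_prismCycle, hni, hnj, false_and, if_false] at hli hlj
  have hpar : (edgeCount (fun t => SeqComplete G y K (q i t)) (m i) +
      edgeCount (fun t => SeqComplete G y K (q j t)) (m j) +
      (if SeqComplete G y K (q i (m i)) ∧ SeqComplete G y K (q j (m j)) then 1 else 0)) % 2 = 1 := by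
    rw [Nat.even_iff] at hli hlj
    have h1 := hb _ _ hij
    have h2 := hb _ _ hil
    have h3 := hb _ _ hjl
    split_ifs at hli hlj ⊢ <;> first | omega | (exfalso; tauto)
  have hd : ∀ i, ∀ t ≤ m i, ∀ s ≤ K, q i (m i - t) ≠ y s := fun i t ht s hs =>
    hdisj i _ (by omega) s hs
  have h2i := hp.two_le i
  have h2j := hp.two_le j
  have hcount : ∀ p r : Fin 3, p ≠ r → ¬ SeqComplete G y K (q p 0) →
      edgeCount (fun t => SeqComplete G y K (prismCycle (fun i t => q i (m i - t)) m p r t))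
        (m p + m r + 2) = edgeCount (fun t => SeqComplete G y K (q p t)) (m p) +
      edgeCount (fun t => SeqComplete G y K (q r t)) (m r) +
      (if SeqComplete G y K (q p (m p)) ∧ SeqComplete G y K (q r (m r)) then 1 else 0) := by
    intro p r hpr hn
    rw [edgeCount_prismCycle, edgeCount_reverse (fun t => SeqComplete G y K (q p t)),
      edgeCount_reverse (fun t => SeqComplete G y K (q r t))]
    simp [hn, and_comm]
  rcases hb _ _ hij with h | h
  · refine (hp.reverse.indCycle hij).false_of_odd_edgeCount hG (hp.even_add hG hij)
      (by omega) hy hKe hK (fun a _ s hs => prismCycle_ne (fun i t ht => hd i t ht s hs) i j a)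
      (by rwa [prismCycle_zero])
      ?_ (r := m i) (s := m i + 1) (by omega) (by omega) (by omega) (by omega)
      (by rwa [prismCycle_left, Nat.sub_self]) (by rwa [prismCycle_right, Nat.sub_self])
    rw [hcount i j hij hni, Nat.odd_iff, hpar]
  · refine (hp.reverse.indCycle hij.symm).false_of_odd_edgeCount hG (hp.even_add hG hij.symm)
      (by omega) hy hKe hK (fun a _ s hs => prismCycle_ne (fun i t ht => hd i t ht s hs) j i a)
      (by rwa [prismCycle_zero])
      ?_ (r := m j + 1) (s := m j) (by omega) (by omega) (by omega) (by omega)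
      (by rwa [prismCycle_right, Nat.sub_self]) (by rwa [prismCycle_left, Nat.sub_self])
    rw [hcount j i hij.symm hnj, Nat.odd_iff]
    simp only [and_comm (a := SeqComplete G y K (q j (m j)))]
    omega

/-- A sequence in `Y`, with consecutive members nonadjacent, whose first member is nonadjacent to
`u` and whose last member is nonadjacent to `v`. -/
structure AntiSeq (G : SimpleGraph V) (Y : Set V) (u v : V) (y : ℕ → V) (K : ℕ) : Prop where
  mem : ∀ t ≤ K, y t ∈ Y
  adj : ∀ t < K, Gᶜ.Adj (y t) (y (t + 1))
  first : ¬ G.Adj u (y 0)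
  last : ¬ G.Adj v (y K)

lemma AntiSeq.sub {Y : Set V} {u v u' v' : V} {y : ℕ → V} {K : ℕ} (h : AntiSeq G Y u v y K)
    {s t : ℕ} (hst : s ≤ t) (ht : t ≤ K) (hu : ¬ G.Adj u' (y s)) (hv : ¬ G.Adj v' (y t)) :
    AntiSeq G Y u' v' (fun x => y (x + s)) (t - s) where
  mem x hx := h.mem _ (by omega)
  adj x hx := by
    have := h.adj (x + s) (by omega)
    rwa [Nat.add_right_comm] at this
  first := by simpa using hu
  last := by simpa [Nat.sub_add_cancel hst] using hv

lemma AntiSeq.splice {Y : Set V} {u v : V} {y : ℕ → V} {K : ℕ} (h : AntiSeq G Y u v y K)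
    {a d : ℕ} (had : a + d ≤ K) (hadj : a + d < K → Gᶜ.Adj (y a) (y (a + d + 1)))
    (hend : a + d = K → y a = y K) :
    AntiSeq G Y u v (fun t => if t ≤ a then y t else y (t + d)) (K - d) where
  mem t ht := by
    split_ifs <;> exact h.mem _ (by omega)
  adj t ht := by
    rcases lt_trichotomy t a with hlt | rfl | hlt
    · rw [if_pos hlt.le, if_pos (by omega)]
      exact h.adj t (by omega)
    · rw [if_pos le_rfl, if_neg (by omega), Nat.add_right_comm]
      exact hadj (by omega)
    · rw [if_neg (by omega), if_neg (by omega), Nat.add_right_comm]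
      exact h.adj (t + d) (by omega)
  first := by simpa using h.first
  last := by
    split_ifs with h'
    · rw [show K - d = a by omega, hend (by omega)]
      exact h.last
    · rw [Nat.sub_add_cancel (by omega)]
      exact h.last

lemma AntiSeq.indPath {Y : Set V} {u v : V} {y : ℕ → V} {K : ℕ} (h : AntiSeq G Y u v y K)
    (hmin : ∀ K' < K, ∀ y', ¬ AntiSeq G Y u v y' K') : IndPath Gᶜ y K := by
  intro a b hab hb
  refine ⟨fun heq => ?_, fun hadj => ?_, ?_⟩
  · refine hmin (K - (b - a)) (by omega) _ (h.splice (a := a) (d := b - a) (by omega) ?_ ?_)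
    · intro hlt
      rw [heq, show a + (b - a) + 1 = b + 1 by omega]
      exact h.adj b (by omega)
    · intro hK
      rw [heq, show b = K by omega]
  · by_contra hne
    refine hmin (K - (b - a - 1)) (by omega) _
      (h.splice (a := a) (d := b - a - 1) (by omega) ?_ ?_)
    · intro _
      rwa [show a + (b - a - 1) + 1 = b by omega]
    · omega
  · rintro rfl
    exact h.adj a (by omega)

/-- In a shortest such sequence, nonneighbours of distinct `c p` and `c r` occur only at the two
different ends. -/
lemma AntiSeq.ends {Y : Set V} {u v : V} {y : ℕ → V} {K : ℕ} (h : AntiSeq G Y u v y K)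
    {c : Fin 3 → V} (hmin : ∀ K' < K, ∀ p r, p ≠ r → ∀ y', ¬ AntiSeq G Y (c p) (c r) y' K')
    {p r : Fin 3} (hpr : p ≠ r) {s t : ℕ} (hs : s ≤ K) (ht : t ≤ K) (hps : ¬ G.Adj (c p) (y s))
    (hrt : ¬ G.Adj (c r) (y t)) : (s = 0 ∧ t = K) ∨ (s = K ∧ t = 0) := by
  by_contra hne
  rcases le_total s t with hst | hst
  · exact hmin (t - s) (by omega) p r hpr _ (h.sub hst ht hps hrt)
  · exact hmin (s - t) (by omega) r p hpr.symm _ (h.sub hst hs hrt hps)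

lemma attachedAt_of_ends {y : ℕ → V} {K : ℕ} (hK : 1 ≤ K) {c : Fin 3 → V}
    (hne : ∀ p, ∀ t ≤ K, c p ≠ y t)
    (hends : ∀ p r, p ≠ r → ∀ s ≤ K, ∀ t ≤ K, ¬ G.Adj (c p) (y s) → ¬ G.Adj (c r) (y t) →
      (s = 0 ∧ t = K) ∨ (s = K ∧ t = 0))
    {i j : Fin 3} (hij : i ≠ j) (hi : ¬ G.Adj (c i) (y 0)) (hj : ¬ G.Adj (c j) (y K)) :
    AttachedAt Gᶜ y K 0 (c i) ∧ AttachedAt Gᶜ y K K (c j) ∧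
      ∀ l, l ≠ i → l ≠ j → SeqComplete G y K (c l) := by
  refine ⟨fun t ht => ⟨hne i t ht, fun h => ?_, ?_⟩, fun t ht => ⟨hne j t ht, fun h => ?_, ?_⟩,
    fun l hli hlj t ht => by_contra fun h => ?_⟩
  · have := hends i j hij t ht K le_rfl ((compl_adj _ _ _).1 h).2 hj
    omega
  · rintro rfl
    exact (compl_adj _ _ _).2 ⟨hne i 0 ht, hi⟩
  · have := hends i j hij 0 (by omega) t ht hi ((compl_adj _ _ _).1 h).2
    omega
  · rintro rfl
    exact (compl_adj _ _ _).2 ⟨hne j t ht, hj⟩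
  · have h1 := hends l i hli t ht 0 (by omega) h hi
    have h2 := hends l j hlj t ht K le_rfl h hj
    omega

lemma SeqPrism.compl_adj_ends {q : Fin 3 → ℕ → V} {m : Fin 3 → ℕ} (hp : SeqPrism G q m)
    (i j : Fin 3) : Gᶜ.Adj (q j (m j)) (q i 0) := by
  have hi := hp.two_le i
  have hj := hp.two_le j
  rw [adj_comm, compl_adj]
  by_cases hij : i = j
  · subst hij
    have := hp.indPath i 0 (m i) (by omega) le_rfl
    rw [this.2]
    exact ⟨this.1, by omega⟩
  · have := hp.cross i j hij 0 (m j) (by omega) le_rfl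
    rw [this.2]
    exact ⟨this.1, by omega⟩

lemma SeqPrism.false_of_shortest {q : Fin 3 → ℕ → V} {m : Fin 3 → ℕ} (hp : SeqPrism G q m)
    (hG : IsBerge G) {Y : Set V} (hdisj : ∀ i, ∀ t ≤ m i, q i t ∉ Y)
    (hmaj : ∀ v ∈ Y, ∀ i j, ¬ G.Adj (q i 0) v → ¬ G.Adj (q j 0) v → i = j)
    {K : ℕ} (hminA : ∀ K' < K, ∀ p r, p ≠ r → ∀ y', ¬ AntiSeq G Y (q p 0) (q r 0) y' K')
    (hminB : ∀ K' < K, ∀ p r, p ≠ r → ∀ y', ¬ AntiSeq G Y (q p (m p)) (q r (m r)) y' K')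
    {i j : Fin 3} (hij : i ≠ j) {y : ℕ → V} (hy : AntiSeq G Y (q i 0) (q j 0) y K) : False := by
  have hpath := hy.indPath fun K' hK' => hminA K' hK' i j hij
  have hK : 1 ≤ K := by
    by_contra hK
    obtain rfl : K = 0 := by omega
    exact hij (hmaj _ (hy.mem 0 le_rfl) i j hy.first hy.last)
  have hne : ∀ i, ∀ t ≤ m i, ∀ s ≤ K, q i t ≠ y s := fun i t ht s hs h =>
    hdisj i t ht (h ▸ hy.mem s hs)
  have hthird : ∀ i j : Fin 3, ∃ l, l ≠ i ∧ l ≠ j := by decide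
  obtain ⟨hai, haj, hal⟩ := attachedAt_of_ends (c := fun p => q p 0) hK
    (fun p => hne p 0 (by omega))
    (fun p r hpr s hs t ht => hy.ends (c := fun p => q p 0) hminA hpr hs ht) hij hy.first hy.last
  have heven : ∀ r, SeqComplete G y K (q r (m r)) → Even K := fun r hr =>
    hpath.even_of_cap_close hG.compl hK hai haj
      (fun h => ((compl_adj _ _ _).1 h).2 ((hp.cross i j hij 0 0 (by omega) (by omega)).2.2
        (Or.inl ⟨rfl, rfl⟩)))
      (hp.compl_adj_ends i r) (hp.compl_adj_ends j r)
      (fun t ht h => ((compl_adj _ _ _).1 h).2 (hr t ht))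
  have hK2 : Even K → 2 ≤ K := fun h => by
    rw [Nat.even_iff] at h
    omega
  have hendsB : ∀ p r, p ≠ r → ∀ s ≤ K, ∀ t ≤ K, ¬ G.Adj (q p (m p)) (y s) →
      ¬ G.Adj (q r (m r)) (y t) → (s = 0 ∧ t = K) ∨ (s = K ∧ t = 0) :=
    fun p r hpr s hs t ht => hy.ends (c := fun p => q p (m p)) hminB hpr hs ht
  have hopp : ∀ p r, p ≠ r → ¬ G.Adj (q p (m p)) (y 0) → ¬ G.Adj (q r (m r)) (y K) → False := by
    intro p r hpr hp0 hrK
    obtain ⟨hbp, -, hbl⟩ := attachedAt_of_ends (c := fun p => q p (m p)) hK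
      (fun p => hne p (m p) le_rfl) hendsB hpr hp0 hrK
    obtain ⟨l, hlp, hlr⟩ := hthird p r
    have hev := heven l (hbl l hlp hlr)
    exact Nat.not_even_iff_odd.2
      (hpath.odd_of_cap_adj hG.compl (hK2 hev) hbp haj (hp.compl_adj_ends j p)) hev
  have hb : ∀ p r, p ≠ r → SeqComplete G y K (q p (m p)) ∨ SeqComplete G y K (q r (m r)) := by
    intro p r hpr
    by_contra! hc
    obtain ⟨h1, h2⟩ := hc
    simp only [SeqComplete, not_forall] at h1 h2
    obtain ⟨s, hs, hps⟩ := h1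
    obtain ⟨t, ht, hrt⟩ := h2
    rcases hendsB p r hpr s hs t ht hps hrt with ⟨rfl, rfl⟩ | ⟨rfl, rfl⟩
    · exact hopp p r hpr hps hrt
    · exact hopp r p hpr.symm hrt hps
  have hev : Even K := (hb 0 1 (by decide)).elim (heven 0) (heven 1)
  obtain ⟨l, hli, hlj⟩ := hthird i j
  exact hp.false_of_attached hG hpath hev (hK2 hev) hne hij hli.symm hlj.symm hai haj
    (hal l hli hlj) hb

lemma exists_antiSeq {Y : Set V} (hY : Anticonnected G Y) {u v : V} (hu : u ∉ Y) (hv : v ∉ Y)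
    (hu' : ¬ IsTComplete G Y u) (hv' : ¬ IsTComplete G Y v) : ∃ K y, AntiSeq G Y u v y K := by
  simp only [IsTComplete, hu, hv, not_false_eq_true, true_and, not_forall] at hu' hv'
  obtain ⟨s, hs, hus⟩ := hu'
  obtain ⟨t, ht, hvt⟩ := hv'
  obtain ⟨w⟩ := hY.preconnected ⟨s, hs⟩ ⟨t, ht⟩
  refine ⟨w.length, fun n => w.getVert n, fun n _ => (w.getVert n).2,
    fun n hn => w.adj_getVert_succ hn, by simpa using hus, by simpa using hvt⟩

lemma exists_two_isTComplete {Y : Set V} (hY : Anticonnected G Y) {c : Fin 3 → V}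
    (hc : ∀ p, c p ∉ Y) (hno : ∀ K, ∀ p r, p ≠ r → ∀ y, ¬ AntiSeq G Y (c p) (c r) y K) :
    ∃ i j, i ≠ j ∧ IsTComplete G Y (c i) ∧ IsTComplete G Y (c j) := by
  have h : ∀ p r, p ≠ r → IsTComplete G Y (c p) ∨ IsTComplete G Y (c r) := by
    intro p r hpr
    by_contra! h
    obtain ⟨K, y, hy⟩ := exists_antiSeq hY (hc p) (hc r) h.1 h.2
    exact hno K p r hpr y hy
  rcases h 0 1 (by decide) with h0 | h1
  · rcases h 1 2 (by decide) with h1 | h2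
    · exact ⟨0, 1, by decide, h0, h1⟩
    · exact ⟨0, 2, by decide, h0, h2⟩
  · rcases h 0 2 (by decide) with h0 | h2
    · exact ⟨0, 1, by decide, h0, h1⟩
    · exact ⟨1, 2, by decide, h1, h2⟩

lemma SeqPrism.not_antiSeq {q : Fin 3 → ℕ → V} {m : Fin 3 → ℕ} (hp : SeqPrism G q m)
    (hG : IsBerge G) {Y : Set V} (hdisj : ∀ i, ∀ t ≤ m i, q i t ∉ Y)
    (hmajA : ∀ v ∈ Y, ∀ i j, ¬ G.Adj (q i 0) v → ¬ G.Adj (q j 0) v → i = j)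
    (hmajB : ∀ v ∈ Y, ∀ i j, ¬ G.Adj (q i (m i)) v → ¬ G.Adj (q j (m j)) v → i = j) (K : ℕ) :
    (∀ p r, p ≠ r → ∀ y, ¬ AntiSeq G Y (q p 0) (q r 0) y K) ∧
      ∀ p r, p ≠ r → ∀ y, ¬ AntiSeq G Y (q p (m p)) (q r (m r)) y K := by
  induction K using Nat.strong_induction_on with
  | _ K ih =>
    refine ⟨fun p r hpr y hy => ?_, fun p r hpr y hy => ?_⟩
    · exact hp.false_of_shortest hG hdisj hmajA (fun K' h => (ih K' h).1) (fun K' h => (ih K' h).2)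
        hpr hy
    · refine hp.reverse.false_of_shortest hG (fun i t _ => hdisj i _ (by omega)) hmajB
        (fun K' h => (ih K' h).2) (fun K' h => ?_) hpr hy
      simpa using (ih K' h).1

/-- A vertex adjacent to at least two members of a family of three misses at most one of them. -/
lemma eq_of_two_le_ncard {c : Fin 3 → V} {v : V} (h : 2 ≤ {i : Fin 3 | G.Adj v (c i)}.ncard)
    {i j : Fin 3} (hi : ¬ G.Adj (c i) v) (hj : ¬ G.Adj (c j) v) : i = j := by
  by_contra hij
  obtain ⟨x, y, hx, hy, hxy⟩ := (Set.one_lt_ncard_iff).1 h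
  have hxi : x ≠ i := fun e => hi (e ▸ hx).symm
  have hxj : x ≠ j := fun e => hj (e ▸ hx).symm
  have hyi : y ≠ i := fun e => hi (e ▸ hy).symm
  have hyj : y ≠ j := fun e => hj (e ▸ hy).symm
  omega

lemma indPath_of_embedding {n : ℕ} (hn : 0 < n) (f : pathGraph n ↪g G) :
    IndPath G (fun t => if h : t < n then f ⟨t, h⟩ else f ⟨0, hn⟩) (n - 1) := by
  intro i j hij hj
  dsimp only
  rw [dif_pos (by omega : i < n), dif_pos (by omega : j < n), f.map_adj_iff, pathGraph_adj]
  refine ⟨fun h => ?_, by dsimp only; omega⟩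
  have := congrArg Fin.val (f.injective h)
  dsimp only at this
  omega

end
/-- In a Berge graph, let `K` be a prism all of whose three paths have length at
least 2, and let `Y` be an anticonnected set, disjoint from `K`, each of whose
vertices has at least two neighbours in the triangle `{a 0, a 1, a 2}` and at
least two neighbours in `{b 0, b 1, b 2}`.  Then at least two of the `a i` and
at least two of the `b i` are `Y`-complete. -/
theorem prism_major_anticonnected_set {V : Type} [Fintype V] (G : SimpleGraph V)
    (hG : IsBerge G) (n : Fin 3 → ℕ) (f : ∀ i, pathGraph (n i) ↪g G)
    (a b : Fin 3 → V) (hprism : IsPrismConfig G n f a b)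
    (hlong : ∀ i, 3 ≤ n i)
    (Y : Set V) (hY : Anticonnected G Y)
    (hYdisj : ∀ i, ∀ x, (f i x : V) ∉ Y)
    (hYmaj : ∀ y ∈ Y, 2 ≤ {i : Fin 3 | G.Adj y (a i)}.ncard ∧
                      2 ≤ {i : Fin 3 | G.Adj y (b i)}.ncard) :
    (∃ i j : Fin 3, i ≠ j ∧ IsTComplete G Y (a i) ∧ IsTComplete G Y (a j)) ∧
    (∃ i j : Fin 3, i ≠ j ∧ IsTComplete G Y (b i) ∧ IsTComplete G Y (b j)) := by
  have hpos : ∀ i, 0 < n i := fun i => by have := hlong i; omega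
  obtain ⟨-, ha, hb, hne, haa, hbb, hcross⟩ := hprism
  let q : Fin 3 → ℕ → V := fun i t => if h : t < n i then f i ⟨t, h⟩ else f i ⟨0, hpos i⟩
  have hq : ∀ i t (h : t < n i), q i t = f i ⟨t, h⟩ := fun i t h => dif_pos h
  have hqa : ∀ i, q i 0 = a i := fun i => (hq i 0 (hpos i)).trans (ha i _)
  have hqb : ∀ i, q i (n i - 1) = b i := fun i =>
    (hq i _ (Nat.sub_one_lt (hpos i).ne')).trans (hb i _)
  have hval : ∀ i s t (hs : s < n i) (ht : t < n i), (f i ⟨s, hs⟩ : V) = f i ⟨t, ht⟩ → s = t :=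
    fun i s t hs ht h => congrArg Fin.val ((f i).injective h)
  have hp : SeqPrism G q (fun i => n i - 1) := by
    refine ⟨fun i => ?_, fun i => indPath_of_embedding (hpos i) (f i),
      fun i j hij s t hs ht => ?_⟩
    · have := hlong i
      omega
    · have hi := hpos i
      have hj := hpos j
      have hs' : s < n i := by omega
      have ht' : t < n j := by omega
      refine ⟨by rw [hq i s hs', hq j t ht']; exact hne i j hij _ _, fun h => ?_, ?_⟩
      · rw [hq i s hs', hq j t ht'] at h
        rcases hcross i j hij _ _ h with ⟨h1, h2⟩ | ⟨h1, h2⟩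
        · rw [← ha i hi] at h1
          rw [← ha j hj] at h2
          exact Or.inl ⟨hval _ _ _ _ _ h1, hval _ _ _ _ _ h2⟩
        · rw [← hb i (Nat.sub_one_lt hi.ne')] at h1
          rw [← hb j (Nat.sub_one_lt hj.ne')] at h2
          exact Or.inr ⟨hval _ _ _ _ _ h1, hval _ _ _ _ _ h2⟩
      · rintro (⟨rfl, rfl⟩ | ⟨rfl, rfl⟩)
        · rw [hqa, hqa]
          exact haa i j hij
        · rw [hqb, hqb]
          exact hbb i j hij
  have hdisj : ∀ i, ∀ t ≤ n i - 1, q i t ∉ Y := fun i t ht => by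
    have := hpos i
    rw [hq i t (by omega)]
    exact hYdisj i _
  have hno := hp.not_antiSeq hG hdisj
    (fun v hv i j => by rw [hqa, hqa]; exact eq_of_two_le_ncard (hYmaj v hv).1)
    (fun v hv i j => by rw [hqb, hqb]; exact eq_of_two_le_ncard (hYmaj v hv).2)
  simp only [hqa, hqb] at hno
  exact ⟨exists_two_isTComplete hY (fun p => hqa p ▸ hdisj p 0 (Nat.zero_le _))
      fun K => (hno K).1,
    exists_two_isTComplete hY (fun p => hqb p ▸ hdisj p _ le_rfl) fun K => (hno K).2⟩
end

section
/- A minimally imperfect graph has no even pair (Meyniel's theorem). -/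
open SimpleGraph

/-- A graph is perfect if every induced subgraph has chromatic number equal to
its clique number. -/
def IsPerfect {V : Type} (G : SimpleGraph V) : Prop :=
  ∀ s : Set V, (G.induce s).chromaticNumber = ((G.induce s).cliqueNum : ℕ∞)

/-- A graph is minimally imperfect if it is not perfect but all its proper
induced subgraphs are perfect. -/
def MinimallyImperfect {V : Type} (G : SimpleGraph V) : Prop :=
  ¬ IsPerfect G ∧ ∀ s : Set V, s ≠ Set.univ → IsPerfect (G.induce s)

/-- `{x, y}` is an even pair: `x ≠ y` and every chordless path from `x` to `y`
has even length. -/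
def IsEvenPair {V : Type} (G : SimpleGraph V) (x y : V) : Prop :=
  x ≠ y ∧ ∀ (n : ℕ) (hn : 1 ≤ n) (f : pathGraph n ↪g G),
    (f ⟨0, by omega⟩ : V) = x → (f ⟨n - 1, by omega⟩ : V) = y → Even (n - 1)

namespace SimpleGraph

/-- Clique numbers are monotone under graph embeddings. -/
lemma cliqueNum_le_of_embedding {V W : Type} [Finite W] {G : SimpleGraph V} {H : SimpleGraph W}
    (f : G ↪g H) : G.cliqueNum ≤ H.cliqueNum := by
  obtain ⟨s, hs⟩ := G.exists_isNClique_cliqueNum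
  have hclique : H.IsClique (s.map f.toEmbedding : Finset W) := by
    intro a ha b hb hab
    simp only [Finset.coe_map, Set.mem_image, Finset.mem_coe] at ha hb
    obtain ⟨a, ha, rfl⟩ := ha
    obtain ⟨b, hb, rfl⟩ := hb
    exact f.map_adj_iff.2 (hs.isClique ha hb fun h => hab (h ▸ rfl))
  have hcard := IsClique.card_le_cliqueNum (tc := hclique)
  rwa [Finset.card_map, hs.card_eq] at hcard

/-- If an induced subgraph is colored with `k` colors, then every color occurs on each of its
`k`-cliques. -/
lemma Coloring.exists_mem_of_isNClique {V : Type} {G : SimpleGraph V} {U : Set V} {k : ℕ}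
    (c : (G.induce U).Coloring (Fin k)) {K : Finset V} (hK : G.IsNClique k K)
    (hKU : ∀ v ∈ K, v ∈ U) (i : Fin k) : ∃ v ∈ K, ∃ h : v ∈ U, c ⟨v, h⟩ = i := by
  classical
  have hinj : Function.Injective fun v : K => c ⟨v, hKU v v.2⟩ := by
    intro a b hab
    by_contra hne
    exact c.valid (v := ⟨a, hKU a a.2⟩) (w := ⟨b, hKU b b.2⟩)
      (hK.isClique a.2 b.2 fun h => hne (Subtype.ext h)) hab
  have hbij := (Fintype.bijective_iff_injective_and_card _).2 ⟨hinj, by simp [hK.card_eq]⟩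
  obtain ⟨v, hv⟩ := hbij.2 i
  exact ⟨v, v.2, hKU v v.2, hv⟩

/-- A shortest walk is a chordless path. -/
lemma Walk.exists_pathGraph_embedding {V : Type} {G : SimpleGraph V} {x y : V}
    (p : G.Walk x y) (hp : p.length = G.dist x y) :
    ∃ f : pathGraph (p.length + 1) ↪g G, ∀ i, f i = p.getVert i := by
  have hle : ∀ i j : ℕ, i ≤ p.length → j ≤ p.length →
      ∀ q : G.Walk (p.getVert i) (p.getVert j), j ≤ i + q.length := by
    intro i j hi hj q
    have h := dist_le (((p.take i).append q).append (p.drop j))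
    simp only [Walk.length_append, Walk.take_length, Walk.drop_length] at h
    omega
  have hinj : ∀ i j : ℕ, i ≤ p.length → j ≤ p.length → p.getVert i = p.getVert j → j ≤ i := by
    intro i j hi hj hij
    simpa using hle i j hi hj (Walk.nil.copy rfl hij)
  have hadj : ∀ i j : ℕ, i ≤ p.length → j ≤ p.length →
      G.Adj (p.getVert i) (p.getVert j) → j ≤ i + 1 := by
    intro i j hi hj hij
    simpa using hle i j hi hj hij.toWalk
  have hinj' : Function.Injective fun i : Fin (p.length + 1) => p.getVert i := by
    intro i j hij
    have := hinj i j (by omega) (by omega) hij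
    have := hinj j i (by omega) (by omega) hij.symm
    omega
  refine ⟨⟨⟨_, hinj'⟩, ?_⟩, fun i => rfl⟩
  intro i j
  change G.Adj (p.getVert i) (p.getVert j) ↔ _
  rw [pathGraph_adj]
  constructor
  · intro h
    have h1 := hadj i j (by omega) (by omega) h
    have h2 := hadj j i (by omega) (by omega) h.symm
    have h3 : i.val ≠ j.val := fun hij => h.ne (by rw [hij])
    omega
  · rintro (h | h)
    · rw [← h]
      exact p.adj_getVert_succ (by omega)
    · rw [← h]
      exact (p.adj_getVert_succ (by omega)).symm

/-- Adding a stable set costs at most one color. -/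
lemma Colorable.succ_of_isIndepSet_compl {V : Type} {G : SimpleGraph V} {S : Set V}
    (hS : G.IsIndepSet S) {k : ℕ} (h : (G.induce Sᶜ).Colorable k) : G.Colorable (k + 1) := by
  classical
  obtain ⟨c⟩ := h
  refine ⟨Coloring.mk
    (fun v => if hv : v ∈ S then Fin.last k else (c ⟨v, hv⟩).castSucc) ?_⟩
  intro v w hvw
  by_cases hv : v ∈ S <;> by_cases hw : w ∈ S
  · exact absurd hvw (hS hv hw hvw.ne)
  · simp [hv, hw, (Fin.castSucc_lt_last _).ne']
  · simp [hv, hw]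
  · simpa [hv, hw] using c.valid (v := ⟨v, hv⟩) (w := ⟨w, hw⟩) hvw

end SimpleGraph

/-- A perfect graph can be colored with as many colors as its clique number. -/
lemma IsPerfect.colorable {V : Type} [Finite V] {G : SimpleGraph V} (h : IsPerfect G) :
    G.Colorable G.cliqueNum := by
  have h1 : (G.induce Set.univ).Colorable G.cliqueNum :=
    (chromaticNumber_le_iff_colorable.1 (h Set.univ).le).mono (G.cliqueNum_induce_le _)
  exact h1.of_hom G.induceUnivIso.symm.toHom

lemma isPerfect_of_colorable {V : Type} [Finite V] {G : SimpleGraph V}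
    (h : ∀ s : Set V, (G.induce s).Colorable (G.induce s).cliqueNum) : IsPerfect G :=
  fun s => le_antisymm (chromaticNumber_le_iff_colorable.2 (h s)) cliqueNum_le_chromaticNumber

lemma MinimallyImperfect.not_colorable {V : Type} [Finite V] {G : SimpleGraph V}
    (hG : MinimallyImperfect G) : ¬ G.Colorable G.cliqueNum := by
  intro hc
  refine hG.1 (isPerfect_of_colorable fun s => ?_)
  by_cases hs : s = Set.univ
  · subst hs
    exact (hc.of_hom G.induceUnivIso.toHom).mono
      (cliqueNum_le_of_embedding G.induceUnivIso.symm.toEmbedding)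
  · exact (hG.2 s hs).colorable

/-- In a minimally imperfect graph, every stable set misses some maximum clique. -/
lemma MinimallyImperfect.exists_isNClique_disjoint {V : Type} [Finite V] {G : SimpleGraph V}
    (hG : MinimallyImperfect G) {S : Set V} (hS : G.IsIndepSet S) :
    ∃ K, G.IsNClique G.cliqueNum K ∧ ∀ v ∈ K, v ∉ S := by
  by_contra! hmeet
  obtain ⟨K, hK⟩ := G.exists_isNClique_cliqueNum
  obtain ⟨v, -, hv⟩ := hmeet K hK
  have hcol := (hG.2 Sᶜ fun h => (h ▸ Set.mem_univ v : v ∈ Sᶜ) hv).colorable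
  obtain ⟨L, hL⟩ := (G.induce Sᶜ).exists_isNClique_cliqueNum
  have hlt : (G.induce Sᶜ).cliqueNum < G.cliqueNum := by
    refine lt_of_le_of_ne (G.cliqueNum_induce_le _) fun heq => ?_
    rw [heq, isNClique_induce_iff] at hL
    obtain ⟨w, hw, hwS⟩ := hmeet _ hL
    obtain ⟨u, -, rfl⟩ := Finset.mem_map.1 hw
    exact u.2 hwS
  exact hG.not_colorable ((Colorable.succ_of_isIndepSet_compl hS hcol).mono hlt)

/-- For distinct vertices `x`, `y` of a minimally imperfect graph, some stable set contains `y`,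
avoids `x`, and meets every maximum clique avoiding `x`. -/
lemma MinimallyImperfect.exists_isIndepSet {V : Type} [Finite V] {G : SimpleGraph V}
    (hG : MinimallyImperfect G) {x y : V} (hxy : x ≠ y) :
    ∃ S : Set V, G.IsIndepSet S ∧ y ∈ S ∧ x ∉ S ∧
      ∀ K, G.IsNClique G.cliqueNum K → x ∉ K → ∃ v ∈ K, v ∈ S := by
  have hcol := (hG.2 {x}ᶜ fun h => (h ▸ Set.mem_univ x : x ∈ ({x}ᶜ : Set V)) rfl).colorable
  obtain ⟨c⟩ := hcol.mono (G.cliqueNum_induce_le _)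
  have hy : y ∈ ({x}ᶜ : Set V) := hxy.symm
  refine ⟨{v | ∃ h : v ∈ ({x}ᶜ : Set V), c ⟨v, h⟩ = c ⟨y, hy⟩}, ?_, ⟨hy, rfl⟩,
    fun ⟨h, _⟩ => h rfl, ?_⟩
  · rintro v ⟨hv, hcv⟩ w ⟨hw, hcw⟩ - hvw
    exact c.valid (v := ⟨v, hv⟩) (w := ⟨w, hw⟩) hvw (hcv.trans hcw.symm)
  · intro K hK hxK
    exact c.exists_mem_of_isNClique hK (fun v hv h => hxK (h ▸ hv)) _

/-- The members of an even pair lie in different components of the bipartite graph induced by two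
stable sets, each containing exactly one of them. -/
lemma IsEvenPair.not_reachable {V : Type} {G : SimpleGraph V} {x y : V} (h : IsEvenPair G x y)
    {S T : Set V} (hS : G.IsIndepSet S) (hT : G.IsIndepSet T) (hyS : y ∈ S)
    (hxT : x ∈ T) (hyT : y ∉ T) :
    ¬ (G.induce (S ∪ T)).Reachable ⟨x, Or.inr hxT⟩ ⟨y, Or.inl hyS⟩ := by
  classical
  intro hr
  obtain ⟨p, hp⟩ := hr.exists_walk_length_eq_dist
  obtain ⟨f, hf⟩ := p.exists_pathGraph_embedding hp
  have heven : Even p.length :=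
    h.2 (p.length + 1) (by omega) ((Embedding.induce (S ∪ T)).comp f)
      (by simp [hf]) (by simp [hf])
  let c : (G.induce (S ∪ T)).Coloring Bool := Coloring.mk (fun v => decide (v.1 ∈ T)) (by
    intro v w hvw hcol
    have hvw' : G.Adj v w := hvw
    have hiff : v.1 ∈ T ↔ w.1 ∈ T := by simpa using hcol
    by_cases hv : v.1 ∈ T
    · exact hT hv (hiff.1 hv) hvw'.ne hvw'
    · exact hS (v.2.resolve_right hv) (w.2.resolve_right (hiff.not.1 hv)) hvw'.ne hvw')
  have hcongr : decide (x ∈ T) = true ↔ decide (y ∈ T) = true :=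
    (c.even_length_iff_congr p).1 heven
  exact hyT (by simpa [hxT] using hcongr)

/-- Meyniel's theorem: a minimally imperfect graph has no even pair. -/
theorem meyniel_no_even_pair {V : Type} [Fintype V] (G : SimpleGraph V)
    (hG : MinimallyImperfect G) : ¬ ∃ x y : V, IsEvenPair G x y := by
  rintro ⟨x, y, hxy⟩
  obtain ⟨S, hS, hyS, hxS, hSK⟩ := hG.exists_isIndepSet hxy.1
  obtain ⟨T, hT, hxT, hyT, hTK⟩ := hG.exists_isIndepSet hxy.1.symm
  have hnr := hxy.not_reachable hS hT hyS hxT hyT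
  -- Exchange `S` and `T` on the component `A` of `x` in the graph induced by `S ∪ T`.
  let A : Set V := {v | ∃ h : v ∈ S ∪ T, (G.induce (S ∪ T)).Reachable ⟨x, Or.inr hxT⟩ ⟨v, h⟩}
  have hA : ∀ u v, u ∈ A → v ∈ S ∪ T → G.Adj u v → v ∈ A := by
    rintro u v ⟨hu, hru⟩ hv huv
    have huv' : (G.induce (S ∪ T)).Adj ⟨u, hu⟩ ⟨v, hv⟩ := huv
    exact ⟨hv, hru.trans huv'.reachable⟩
  have hxA : x ∈ A := ⟨Or.inr hxT, Reachable.refl _⟩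
  have hyA : y ∉ A := fun ⟨_, h⟩ => hnr h
  have hind : G.IsIndepSet (S \ A ∪ T ∩ A) := by
    rintro u (⟨hu, huA⟩ | ⟨hu, huA⟩) v (⟨hv, hvA⟩ | ⟨hv, hvA⟩) hne huv
    · exact hS hu hv hne huv
    · exact huA (hA v u hvA (Or.inl hu) huv.symm)
    · exact hvA (hA u v huA (Or.inl hv) huv)
    · exact hT hu hv hne huv
  obtain ⟨K, hK, hdisj⟩ := hG.exists_isNClique_disjoint hind
  have hxK : x ∉ K := fun h => hdisj x h (Or.inr ⟨hxT, hxA⟩)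
  have hyK : y ∉ K := fun h => hdisj y h (Or.inl ⟨hyS, hyA⟩)
  obtain ⟨s, hsK, hs⟩ := hSK K hK hxK
  obtain ⟨t, htK, ht⟩ := hTK K hK hyK
  have hsA : s ∈ A := by_contra fun h => hdisj s hsK (Or.inl ⟨hs, h⟩)
  have htA : t ∉ A := fun h => hdisj t htK (Or.inr ⟨ht, h⟩)
  have hst : s ≠ t := fun h => htA (h ▸ hsA)
  exact htA (hA s t hsA (Or.inr ht) (hK.isClique hsK htK hst))
end

section
/- If G is a perfect graph and {x, y} is an even pair in G, then the graph G/xy obtained by contracting x and y is perfect and has the same chromatic number as G (Fonlupt and Uhry). -/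
open SimpleGraph

/-- The contraction `G/xy` of the two (non-adjacent) vertices `x` and `y`:
`y` is removed and `x` plays the role of the new contracted vertex, adjacent
to every vertex that was adjacent to `x` or to `y`. -/
def contractPair {V : Type} (G : SimpleGraph V) (x y : V) :
    SimpleGraph {z : V // z ≠ y} :=
  SimpleGraph.fromRel fun a b =>
    G.Adj a.val b.val ∨ (a.val = x ∧ G.Adj y b.val) ∨ (b.val = x ∧ G.Adj a.val y)

namespace SimpleGraph

variable {V W : Type*} {G : SimpleGraph V} {x y : V}

theorem Walk.dist_getVert_of_length_eq_dist {p : G.Walk x y} (hp : p.length = G.dist x y)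
    {i : ℕ} (hi : i ≤ p.length) : G.dist x (p.getVert i) = i := by
  rw [← length_eq_dist_of_subwalk hp (p.isSubwalk_take i), Walk.take_length, min_eq_left hi]

/-- A shortest walk, viewed as an embedding of a path graph. -/
def Walk.pathGraphEmbedding (p : G.Walk x y) (hp : p.length = G.dist x y) :
    pathGraph (p.length + 1) ↪g G where
  toFun i := p.getVert i
  inj' i j h := by
    have h' : G.dist x (p.getVert i) = G.dist x (p.getVert j) := congrArg (G.dist x) h
    rw [dist_getVert_of_length_eq_dist hp (by omega),
      dist_getVert_of_length_eq_dist hp (by omega)] at h'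
    exact Fin.ext h'
  map_rel_iff' := by
    intro i j
    rw [pathGraph_adj]
    change G.Adj (p.getVert i) (p.getVert j) ↔ _
    constructor
    · intro h
      have hdist := h.diff_dist_adj (u := x)
      rw [dist_getVert_of_length_eq_dist hp (by omega),
        dist_getVert_of_length_eq_dist hp (by omega)] at hdist
      have : (i : ℕ) ≠ j := fun hij => h.ne (by rw [hij])
      omega
    · rintro (h | h)
      · rw [← h]
        exact p.adj_getVert_succ (by omega)
      · rw [← h]
        exact (p.adj_getVert_succ (by omega)).symm

theorem Hom.cliqueNum_le [Finite V] [Finite W] {H : SimpleGraph W} (f : G →g H) :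
    G.cliqueNum ≤ H.cliqueNum := by
  classical
  obtain ⟨t, ht⟩ := G.exists_isNClique_cliqueNum
  have hinj : Set.InjOn f t := fun a ha b hb hab => by
    by_contra hne
    exact (f.map_adj (ht.isClique ha hb hne)).ne hab
  have hclique : H.IsClique (t.image f : Finset W) := by
    rw [Finset.coe_image]
    rintro _ ⟨a, ha, rfl⟩ _ ⟨b, hb, rfl⟩ hne
    exact f.map_adj (ht.isClique ha hb fun hab => hne (congrArg f hab))
  rw [← ht.card_eq, ← Finset.card_image_of_injOn hinj]
  exact hclique.card_le_cliqueNum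

end SimpleGraph

namespace IsEvenPair

variable {V : Type} {G : SimpleGraph V} {x y : V}

theorem induce (h : IsEvenPair G x y) {s : Set V} (hx : x ∈ s) (hy : y ∈ s) :
    IsEvenPair (G.induce s) ⟨x, hx⟩ ⟨y, hy⟩ := by
  refine ⟨fun hxy => h.1 (congrArg Subtype.val hxy), fun n hn f hfx hfy => ?_⟩
  exact h.2 n hn (f.trans (Embedding.induce s)) (congrArg Subtype.val hfx)
    (congrArg Subtype.val hfy)

theorem even_dist (h : IsEvenPair G x y) (hr : G.Reachable x y) : Even (G.dist x y) := by
  obtain ⟨p, hp⟩ := hr.exists_walk_length_eq_dist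
  rw [← hp]
  exact h.2 (p.length + 1) (by omega) (p.pathGraphEmbedding hp) p.getVert_zero p.getVert_length

theorem not_adj (h : IsEvenPair G x y) : ¬ G.Adj x y := fun hadj => by
  have := h.even_dist hadj.reachable
  rw [dist_eq_one_iff_adj.mpr hadj] at this
  exact Nat.not_even_one this

/-- The two vertices of an even pair lie in different Kempe components whenever their colors
differ. -/
theorem not_reachable_induce_colors (h : IsEvenPair G x y) {α : Type*} (c : G.Coloring α)
    (hc : c x ≠ c y) :
    ¬ (G.induce {v | c v = c x ∨ c v = c y}).Reachable ⟨x, Or.inl rfl⟩ ⟨y, Or.inr rfl⟩ := by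
  classical
  intro hr
  obtain ⟨p, hp⟩ := hr.exists_walk_length_eq_dist
  have heven := (h.induce (s := {v | c v = c x ∨ c v = c y}) (Or.inl rfl) (Or.inr rfl)).even_dist hr
  let b : (G.induce {v | c v = c x ∨ c v = c y}).Coloring Bool :=
    Coloring.mk (fun v => decide (c v = c x)) (by
      rintro ⟨u, hu⟩ ⟨v, hv⟩ huv heq
      have hne : c u ≠ c v := c.valid huv
      simp only [decide_eq_decide] at heq
      rcases hu with hu | hu <;> rcases hv with hv | hv <;> grind)
  rw [← hp, b.even_length_iff_congr p] at heven
  have hbxy : decide (c x = c x) = true ↔ decide (c y = c x) = true := heven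
  simp only [decide_true, true_iff, decide_eq_true_eq] at hbxy
  exact hc hbxy.symm

/-- Swapping two colors on a Kempe component makes the colors of an even pair agree. -/
theorem exists_coloring_eq (h : IsEvenPair G x y) {α : Type*} (c : G.Coloring α) :
    ∃ c' : G.Coloring α, c' x = c' y := by
  classical
  by_cases hc : c x = c y
  · exact ⟨c, hc⟩
  let R : V → Prop := fun v => ∃ hv : c v = c x ∨ c v = c y,
    (G.induce {v | c v = c x ∨ c v = c y}).Reachable ⟨x, Or.inl rfl⟩ ⟨v, hv⟩
  have hRx : R x := ⟨Or.inl rfl, Reachable.refl _⟩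
  have hRy : ¬ R y := fun ⟨_, hy⟩ => h.not_reachable_induce_colors c hc hy
  have hstep : ∀ {u v}, G.Adj u v → R u → ¬ R v → c v ≠ c x ∧ c v ≠ c y := by
    rintro u v huv ⟨hu, hru⟩ hv
    by_contra hcol
    have hvK : c v = c x ∨ c v = c y := by tauto
    exact hv ⟨hvK, hru.trans (Adj.reachable (induce_adj.mpr huv))⟩
  have hswap : ∀ {u v}, G.Adj u v → R u → ¬ R v → Equiv.swap (c x) (c y) (c u) ≠ c v := by
    intro u v huv hu hv
    obtain ⟨h1, h2⟩ := hstep huv hu hv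
    obtain ⟨hcu | hcu, -⟩ := hu
    · rw [hcu, Equiv.swap_apply_left]
      exact h2.symm
    · rw [hcu, Equiv.swap_apply_right]
      exact h1.symm
  refine ⟨Coloring.mk (fun v => if R v then Equiv.swap (c x) (c y) (c v) else c v) ?_, ?_⟩
  · intro u v huv
    by_cases hu : R u <;> by_cases hv : R v <;> simp only [hu, hv, if_true, if_false]
    · exact (Equiv.injective _).ne (c.valid huv)
    · exact hswap huv hu hv
    · exact (hswap huv.symm hv hu).symm
    · exact c.valid huv
  · change (if R x then _ else _) = if R y then _ else _
    rw [if_pos hRx, if_neg hRy, Equiv.swap_apply_left]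

end IsEvenPair

section Contraction

variable {V : Type} {G : SimpleGraph V} {x y : V}

/-- The quotient map onto the vertices of the contraction, sending `y` to `x`. -/
def contractMap [DecidableEq V] (hxy : x ≠ y) (v : V) : {z : V // z ≠ y} :=
  if h : v = y then ⟨x, hxy⟩ else ⟨v, h⟩

/-- The quotient map is a homomorphism when the contracted vertices are not adjacent. -/
def contractHom [DecidableEq V] (hxy : x ≠ y) (hadj : ¬ G.Adj x y) :
    G →g contractPair G x y where
  toFun := contractMap hxy
  map_rel' := by
    intro a b hab
    have hne := hab.ne
    have hsymm := hab.symm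
    simp only [contractPair, fromRel_adj, contractMap]
    grind

theorem exists_coloring_induce_contractPair [DecidableEq V] (h : IsEvenPair G x y)
    (s : Set {z : V // z ≠ y}) {α : Type*}
    (c : (G.induce (contractMap h.1 ⁻¹' s)).Coloring α) :
    Nonempty (((contractPair G x y).induce s).Coloring α) := by
  have hmap (a : {z : V // z ≠ y}) : contractMap h.1 a.val = a := dif_neg a.2
  have hmapy : contractMap h.1 y = ⟨x, h.1⟩ := dif_pos rfl
  have hmem (a : s) : a.val.val ∈ contractMap h.1 ⁻¹' s := by
    rw [Set.mem_preimage, hmap]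
    exact a.2
  obtain ⟨c', hc'⟩ : ∃ c' : (G.induce (contractMap h.1 ⁻¹' s)).Coloring α,
      ∀ (hx : x ∈ contractMap h.1 ⁻¹' s) (hy : y ∈ contractMap h.1 ⁻¹' s),
        c' ⟨x, hx⟩ = c' ⟨y, hy⟩ := by
    by_cases hx : x ∈ contractMap h.1 ⁻¹' s
    · by_cases hy : y ∈ contractMap h.1 ⁻¹' s
      · obtain ⟨c', hc'⟩ := (h.induce hx hy).exists_coloring_eq c
        exact ⟨c', fun _ _ => hc'⟩
      · exact ⟨c, fun _ hy' => absurd hy' hy⟩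
    · exact ⟨c, fun hx' => absurd hx' hx⟩
  have key : ∀ a b : s, a.val.val = x → G.Adj y b.val.val →
      c' ⟨a.val.val, hmem a⟩ ≠ c' ⟨b.val.val, hmem b⟩ := by
    intro a b hax hyb
    have hx : x ∈ contractMap h.1 ⁻¹' s := hax ▸ hmem a
    have hy : y ∈ contractMap h.1 ⁻¹' s := by
      rw [Set.mem_preimage, hmapy, ← hmap ⟨x, h.1⟩]
      exact hx
    have hne : c' ⟨y, hy⟩ ≠ c' ⟨b.val.val, hmem b⟩ := c'.valid (induce_adj.mpr hyb)
    have heq : (⟨a.val.val, hmem a⟩ : contractMap h.1 ⁻¹' s) = ⟨x, hx⟩ := Subtype.ext hax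
    rwa [heq, hc' hx hy]
  have key' : ∀ a b : s, G.Adj a.val.val b.val.val →
      c' ⟨a.val.val, hmem a⟩ ≠ c' ⟨b.val.val, hmem b⟩ :=
    fun a b hab => c'.valid (induce_adj.mpr hab)
  refine ⟨Coloring.mk (fun a => c' ⟨a.val.val, hmem a⟩) ?_⟩
  intro a b hab
  rw [induce_adj, contractPair, fromRel_adj] at hab
  rcases hab.2 with (hab | ⟨ha, hb⟩ | ⟨hb, ha⟩) | (hab | ⟨hb, ha⟩ | ⟨ha, hb⟩)
  · exact key' a b hab
  · exact key a b ha hb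
  · exact (key b a hb ha.symm).symm
  · exact (key' b a hab).symm
  · exact (key b a hb ha).symm
  · exact key a b ha hb.symm

/-- The restriction of the quotient map to the preimage of a vertex set. -/
def induceContractHom [DecidableEq V] (h : IsEvenPair G x y) (s : Set {z : V // z ≠ y}) :
    G.induce (contractMap h.1 ⁻¹' s) →g (contractPair G x y).induce s where
  toFun v := ⟨contractMap h.1 v.val, v.2⟩
  map_rel' hab := (contractHom h.1 h.not_adj).map_adj hab

theorem chromaticNumber_induce_contractPair [DecidableEq V] (h : IsEvenPair G x y)
    (s : Set {z : V // z ≠ y}) :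
    ((contractPair G x y).induce s).chromaticNumber =
      (G.induce (contractMap h.1 ⁻¹' s)).chromaticNumber :=
  le_antisymm
    (chromaticNumber_le_of_forall_imp fun _ ⟨c⟩ => exists_coloring_induce_contractPair h s c)
    (chromaticNumber_mono_of_hom (induceContractHom h s))

end Contraction

/-- Fonlupt and Uhry: contracting an even pair of a perfect graph yields a
perfect graph with the same chromatic number. -/
theorem fonlupt_uhry {V : Type} [Fintype V] [DecidableEq V] (G : SimpleGraph V)
    (x y : V) (hG : IsPerfect G) (hxy : IsEvenPair G x y) :
    IsPerfect (contractPair G x y) ∧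
      (contractPair G x y).chromaticNumber = G.chromaticNumber := by
  refine ⟨fun s => le_antisymm ?_ cliqueNum_le_chromaticNumber, ?_⟩
  · rw [chromaticNumber_induce_contractPair hxy s, hG]
    exact_mod_cast (induceContractHom hxy s).cliqueNum_le
  · have := chromaticNumber_induce_contractPair hxy Set.univ
    rw [Set.preimage_univ] at this
    rwa [chromaticNumber_congr (induceUnivIso _), chromaticNumber_congr (induceUnivIso G)] at this
end
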